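/- arXiv:1306.2582 — 3 statements merged into one kernel-verified Lean document; each statement's English description precedes it below -/
import Mathlib

section
/- Let a be a detecting subalgebra and M an indecomposable a-supermodule. If M is endotrivial, then M lies in the principal block; that is, all even elements of a act on M by zero. -/
/-!
A concrete model of the supermodule categories of the paper "On Endotrivial
Modules for Lie Superalgebras" attached to the detecting subalgebras
`e_r = q(1)^{×r}`, `f_n = sl(1|1)^{×n}`, to rank-one subalgebras `⟨z⟩` of
`sl(1|1)`, and to the exterior superalgebras `V(a_r) = Λ((a_r)₁)`.

A `GSupMod k ι` is a finite-dimensional `ℤ₂`-graded `k`-vector space together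
with a family of odd operators `θ i` (the actions of the distinguished odd
basis elements of the superalgebra: the `e_i` for `e_r`, the `x_i, y_i` for
`f_n`, the `a_i` for `V(a_r)`).  The even parts of all these superalgebras are
generated by the brackets of the odd generators, so the relations defining
each particular category, as well as complete reducibility over the even part,
are imposed by a predicate `𝒞 : GSupMod k ι → Prop`, defined separately for
each case.  All categorical notions (homomorphisms, isomorphisms, direct sums,
tensor products, duals, internal Hom, trivial modules, projectivity,
projective covers and injective hulls, syzygies `Ωⁿ` for `n : ℤ`, endotrivial
modules, and the group `T` of stable classes of endotrivial modules) are
defined relative to such a predicate.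
-/

noncomputable section

namespace SupCat

open Submodule

/-- A finite-dimensional `ℤ₂`-graded `k`-vector space with a family of odd
operators `θ i`, indexed by `ι` (the underlying data of a supermodule over a
superalgebra whose odd part has a distinguished basis indexed by `ι`). -/
structure GSupMod (k : Type) [Field k] (ι : Type) : Type 1 where
  carrier : Type
  [isAddCommGroup : AddCommGroup carrier]
  [isModule : Module k carrier]
  [isFinite : FiniteDimensional k carrier]
  /-- the even component -/
  ev : Submodule k carrier
  /-- the odd component -/
  od : Submodule k carrier
  isCompl : IsCompl ev od
  /-- the (odd) actions of the distinguished odd basis elements -/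
  θ : ι → (carrier →ₗ[k] carrier)
  θ_ev : ∀ i, ∀ m ∈ ev, θ i m ∈ od
  θ_od : ∀ i, ∀ m ∈ od, θ i m ∈ ev

attribute [instance] GSupMod.isAddCommGroup GSupMod.isModule GSupMod.isFinite

namespace GSupMod

variable {k : Type} [Field k] {ι : Type}

/-- The action of a general odd element `v = ∑ v i • (basis element i)`. -/
def actOf [Fintype ι] (M : GSupMod k ι) (v : ι → k) : M.carrier →ₗ[k] M.carrier :=
  ∑ i, v i • M.θ i

/-- The grading involution `σ` of a supermodule: `+1` on the even part and
`-1` on the odd part. -/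
def sigma (M : GSupMod k ι) : M.carrier →ₗ[k] M.carrier :=
  M.ev.subtype ∘ₗ Submodule.linearProjOfIsCompl M.ev M.od M.isCompl
    - M.od.subtype ∘ₗ Submodule.linearProjOfIsCompl M.od M.ev M.isCompl.symm

/-- `f` is a homomorphism of supermodules (an equivariant linear map of
degree `0̄`). -/
def IsHom (M N : GSupMod k ι) (f : M.carrier →ₗ[k] N.carrier) : Prop :=
  (∀ i, f ∘ₗ M.θ i = N.θ i ∘ₗ f) ∧
  (∀ m ∈ M.ev, f m ∈ N.ev) ∧ (∀ m ∈ M.od, f m ∈ N.od)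

/-- `M ≅ N` as supermodules. -/
def Iso (M N : GSupMod k ι) : Prop :=
  ∃ e : M.carrier ≃ₗ[k] N.carrier, IsHom M N (e : M.carrier →ₗ[k] N.carrier)

/-- `S` is (isomorphic to) the direct sum `A ⊕ B`. -/
def IsDsum (A B S : GSupMod k ι) : Prop :=
  ∃ φ : S.carrier ≃ₗ[k] A.carrier × B.carrier,
    (∀ s, s ∈ S.ev ↔ (φ s).1 ∈ A.ev ∧ (φ s).2 ∈ B.ev) ∧
    (∀ s, s ∈ S.od ↔ (φ s).1 ∈ A.od ∧ (φ s).2 ∈ B.od) ∧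
    ∀ (i : ι) (s : S.carrier),
      φ (S.θ i s) = LinearMap.prodMap (A.θ i) (B.θ i) (φ s)

/-- `M` is (isomorphic to) the trivial supermodule of parity `p`: `k_ev`
for `p = false`, and `k_od = Π(k_ev)` for `p = true`. -/
def IsTrivial (p : Bool) (M : GSupMod k ι) : Prop :=
  Module.finrank k M.carrier = 1 ∧ (∀ i, M.θ i = 0) ∧
    (if p then M.od = ⊤ else M.ev = ⊤)

/-- `M` is indecomposable. -/
def Indecomposable (M : GSupMod k ι) : Prop :=
  (∃ m : M.carrier, m ≠ 0) ∧
  ∀ A B : GSupMod k ι, IsDsum A B M →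
    (∀ a : A.carrier, a = 0) ∨ (∀ b : B.carrier, b = 0)

/-- `M` is a simple supermodule: nonzero, with no proper nonzero graded
invariant submodule. -/
def IsSimple (M : GSupMod k ι) : Prop :=
  (∃ m : M.carrier, m ≠ 0) ∧
  ∀ N : Submodule k M.carrier,
    (∀ i, ∀ m ∈ N, M.θ i m ∈ N) →
    N = (N ⊓ M.ev) ⊔ (N ⊓ M.od) →
    N = ⊥ ∨ N = ⊤

variable (𝒞 : GSupMod k ι → Prop)

/-- `P` is a projective object of the category cut out by `𝒞` (defined by the
lifting property). -/
def IsProjective (P : GSupMod k ι) : Prop :=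
  𝒞 P ∧
  ∀ (M N : GSupMod k ι) (π : M.carrier →ₗ[k] N.carrier)
    (f : P.carrier →ₗ[k] N.carrier),
    𝒞 M → 𝒞 N → IsHom M N π → Function.Surjective π → IsHom P N f →
    ∃ h : P.carrier →ₗ[k] M.carrier, IsHom P M h ∧ π ∘ₗ h = f

/-- `I` is an injective object of the category cut out by `𝒞`. -/
def IsInjective (I : GSupMod k ι) : Prop :=
  𝒞 I ∧
  ∀ (M N : GSupMod k ι) (j : M.carrier →ₗ[k] N.carrier)
    (f : M.carrier →ₗ[k] I.carrier),
    𝒞 M → 𝒞 N → IsHom M N j → Function.Injective j → IsHom M I f →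
    ∃ h : N.carrier →ₗ[k] I.carrier, IsHom N I h ∧ h ∘ₗ j = f

/-- `π : P ↠ M` is a projective cover. -/
def IsProjCover (P M : GSupMod k ι) (π : P.carrier →ₗ[k] M.carrier) : Prop :=
  IsProjective 𝒞 P ∧ IsHom P M π ∧ Function.Surjective π ∧
  ∀ (Q : GSupMod k ι) (f : Q.carrier →ₗ[k] P.carrier),
    𝒞 Q → IsHom Q P f → Function.Surjective (π ∘ₗ f) → Function.Surjective f

/-- `j : M ↪ I` is an injective hull. -/
def IsInjHull (M I : GSupMod k ι) (j : M.carrier →ₗ[k] I.carrier) : Prop :=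
  IsInjective 𝒞 I ∧ IsHom M I j ∧ Function.Injective j ∧
  ∀ (Q : GSupMod k ι) (f : I.carrier →ₗ[k] Q.carrier),
    𝒞 Q → IsHom I Q f → Function.Injective (f ∘ₗ j) → Function.Injective f

/-- `N` is (isomorphic to) the first syzygy `Ω¹(M)`, the kernel of a
projective cover of `M`. -/
def IsSyzygy (M N : GSupMod k ι) : Prop :=
  𝒞 N ∧
  ∃ (P : GSupMod k ι) (π : P.carrier →ₗ[k] M.carrier)
    (i : N.carrier →ₗ[k] P.carrier),
    IsProjCover 𝒞 P M π ∧ IsHom N P i ∧ Function.Injective i ∧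
    LinearMap.range i = LinearMap.ker π

/-- `N` is (isomorphic to) the first cosyzygy `Ω⁻¹(M)`, the cokernel of the
inclusion of `M` into its injective hull. -/
def IsCosyzygy (M N : GSupMod k ι) : Prop :=
  𝒞 N ∧
  ∃ (I : GSupMod k ι) (j : M.carrier →ₗ[k] I.carrier)
    (p : I.carrier →ₗ[k] N.carrier),
    IsInjHull 𝒞 M I j ∧ IsHom I N p ∧ Function.Surjective p ∧
    LinearMap.ker p = LinearMap.range j

/-- `M` has no nonzero projective direct summand (equivalently, since the
category is self-injective, no nonzero projective submodule). -/
def NoProjSummands (M : GSupMod k ι) : Prop :=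
  ∀ A B : GSupMod k ι, IsProjective 𝒞 A → IsDsum A B M → ∀ a : A.carrier, a = 0

/-- `N` is (isomorphic to) `Ω⁰(M)`, the complement of the largest projective
direct summand of `M`. -/
def IsOmegaZero (M N : GSupMod k ι) : Prop :=
  ∃ Q : GSupMod k ι, IsProjective 𝒞 Q ∧ NoProjSummands 𝒞 N ∧ IsDsum N Q M

/-- `N` is (isomorphic to) `Ωⁿ(M)` for `n ∈ ℕ`. -/
def IsOmegaPow : ℕ → GSupMod k ι → GSupMod k ι → Prop
  | 0, M, N => IsOmegaZero 𝒞 M N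
  | n+1, M, N => ∃ L, IsOmegaPow n M L ∧ IsSyzygy 𝒞 L N

/-- `N` is (isomorphic to) `Ω⁻ⁿ(M)` for `n ∈ ℕ`. -/
def IsOmegaNegPow : ℕ → GSupMod k ι → GSupMod k ι → Prop
  | 0, M, N => IsOmegaZero 𝒞 M N
  | n+1, M, N => ∃ L, IsOmegaNegPow n M L ∧ IsCosyzygy 𝒞 L N

/-- `N` is (isomorphic to) the syzygy `Ωⁿ(M)`, for any `n : ℤ`. -/
def IsOmega (n : ℤ) (M N : GSupMod k ι) : Prop :=
  if 0 ≤ n then IsOmegaPow 𝒞 n.toNat M N else IsOmegaNegPow 𝒞 (-n).toNat M N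

/-- `H` is (isomorphic to) the internal Hom supermodule `Hom_k(M,N)` with its
usual grading and the super action of the odd generators
`(θ i · f)(m) = θ i (f m) - (-1)^{|f|} f (θ i m)` (the sign `(-1)^{|f|}` is
expressed via the grading involutions `σ`). -/
def IsHomObj (M N H : GSupMod k ι) : Prop :=
  ∃ φ : H.carrier ≃ₗ[k] (M.carrier →ₗ[k] N.carrier),
    (∀ h, h ∈ H.ev ↔ ((∀ m ∈ M.ev, φ h m ∈ N.ev) ∧ (∀ m ∈ M.od, φ h m ∈ N.od))) ∧
    (∀ h, h ∈ H.od ↔ ((∀ m ∈ M.ev, φ h m ∈ N.od) ∧ (∀ m ∈ M.od, φ h m ∈ N.ev))) ∧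
    ∀ (i : ι) (h : H.carrier),
      φ (H.θ i h) = N.θ i ∘ₗ φ h - (N.sigma ∘ₗ φ h ∘ₗ M.sigma) ∘ₗ M.θ i

/-- `T` is (isomorphic to) the tensor product supermodule `M ⊗_k N` with its
usual grading and the action of the odd generators
`θ i · (m ⊗ n) = (θ i m) ⊗ n + (-1)^{|m|} m ⊗ (θ i n)`. -/
def IsTensorObj (M N T : GSupMod k ι) : Prop :=
  ∃ φ : T.carrier ≃ₗ[k] TensorProduct k M.carrier N.carrier,
    Submodule.map (φ : T.carrier →ₗ[k] TensorProduct k M.carrier N.carrier) T.ev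
      = Submodule.span k
          ({z | ∃ m ∈ M.ev, ∃ n ∈ N.ev, z = m ⊗ₜ[k] n}
            ∪ {z | ∃ m ∈ M.od, ∃ n ∈ N.od, z = m ⊗ₜ[k] n}) ∧
    Submodule.map (φ : T.carrier →ₗ[k] TensorProduct k M.carrier N.carrier) T.od
      = Submodule.span k
          ({z | ∃ m ∈ M.ev, ∃ n ∈ N.od, z = m ⊗ₜ[k] n}
            ∪ {z | ∃ m ∈ M.od, ∃ n ∈ N.ev, z = m ⊗ₜ[k] n}) ∧
    ∀ (i : ι) (t : T.carrier),
      φ (T.θ i t)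
        = TensorProduct.map (M.θ i) (LinearMap.id : N.carrier →ₗ[k] N.carrier) (φ t)
            + TensorProduct.map M.sigma (N.θ i) (φ t)

/-- `D` is (isomorphic to) the dual supermodule `M* = Hom_k(M, k_ev)`, with
the action `(θ i · ψ)(m) = -(-1)^{|ψ|} ψ (θ i m)`. -/
def IsDualObj (M D : GSupMod k ι) : Prop :=
  ∃ φ : D.carrier ≃ₗ[k] Module.Dual k M.carrier,
    (∀ d, d ∈ D.ev ↔ ∀ m ∈ M.od, φ d m = 0) ∧
    (∀ d, d ∈ D.od ↔ ∀ m ∈ M.ev, φ d m = 0) ∧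
    ∀ (i : ι) (d : D.carrier),
      φ (D.θ i d) = - (φ d) ∘ₗ (M.sigma ∘ₗ M.θ i)

/-- `M` is an endotrivial supermodule of the category cut out by `𝒞`:
`Hom_k(M,M) ≅ k_ev ⊕ P` with `P` projective. -/
def IsEndotrivial (M : GSupMod k ι) : Prop :=
  𝒞 M ∧
  ∃ H K P S : GSupMod k ι, IsHomObj M M H ∧ 𝒞 H ∧ IsTrivial false K ∧
    IsProjective 𝒞 P ∧ IsDsum K P S ∧ Iso H S

/-- `M` and `N` are isomorphic in the stable module category: they become
isomorphic after adding projective direct summands. -/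
def StIso (M N : GSupMod k ι) : Prop :=
  ∃ P Q S T : GSupMod k ι, IsProjective 𝒞 P ∧ IsProjective 𝒞 Q ∧
    IsDsum M P S ∧ IsDsum N Q T ∧ Iso S T

/-- `R` is (isomorphic to) the restriction of `M` along the subalgebra of the
odd space spanned by the vectors `ε j`: the same underlying graded vector
space, where the `j`-th odd generator acts as the element `ε j` did on `M`. -/
def IsRestriction {ι' : Type} [Fintype ι] (ε : ι' → ι → k)
    (M : GSupMod k ι) (R : GSupMod k ι') : Prop :=
  ∃ φ : R.carrier ≃ₗ[k] M.carrier,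
    (∀ m, m ∈ R.ev ↔ φ m ∈ M.ev) ∧
    (∀ m, m ∈ R.od ↔ φ m ∈ M.od) ∧
    ∀ (j : ι') (m : R.carrier), φ (R.θ j m) = actOf M (ε j) (φ m)

/-- The radical `Rad(M)` of a supermodule over one of the detecting
superalgebras on the principal block: the span of the images of the odd
generators. -/
def radical (M : GSupMod k ι) : Submodule k M.carrier :=
  ⨆ i, LinearMap.range (M.θ i)

/-- The rank `Rk(M) = dim_k (M / Rad M)`. -/
def rk (M : GSupMod k ι) : ℕ :=
  Module.finrank k (M.carrier ⧸ radical M)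

end GSupMod

open GSupMod

variable {k : Type} [Field k]

/-- The category of supermodules (in the principal block) over the exterior
superalgebra `V(a_r) = Λ((a_r)₁)` on the purely odd abelian `r`-dimensional
space `(a_r)₁`: the odd generators pairwise super-anticommute (in particular
they square to zero).  Complete reducibility over the even part is automatic
since the even part acts by zero. -/
def VCat (k : Type) [Field k] (r : ℕ) : GSupMod k (Fin r) → Prop :=
  fun M => ∀ i j, M.θ i ∘ₗ M.θ j + M.θ j ∘ₗ M.θ i = 0

/-- The relation on endotrivial supermodules inducing the group `T`: stable
isomorphism. -/
def TRel {ι : Type} (𝒞 : GSupMod k ι → Prop) :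
    {M : GSupMod k ι // IsEndotrivial 𝒞 M} →
    {M : GSupMod k ι // IsEndotrivial 𝒞 M} → Prop :=
  fun M N => StIso 𝒞 M.1 N.1

/-- The underlying set of the group `T`: stable isomorphism classes of
endotrivial supermodules. -/
def TGrp {ι : Type} (𝒞 : GSupMod k ι → Prop) : Type 1 := Quot (TRel 𝒞)

/-- The stable class of an endotrivial supermodule. -/
def tmk {ι : Type} (𝒞 : GSupMod k ι → Prop)
    (M : {M : GSupMod k ι // IsEndotrivial 𝒞 M}) : TGrp 𝒞 :=
  Quot.mk (TRel 𝒞) M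

/-- An abelian group structure on `T` whose multiplication, identity and
inverse are induced by tensor product, the trivial module `k_ev` and duality
respectively. -/
structure TGroupData {ι : Type} (𝒞 : GSupMod k ι → Prop) : Type 1 where
  mul : TGrp 𝒞 → TGrp 𝒞 → TGrp 𝒞
  one : TGrp 𝒞
  inv : TGrp 𝒞 → TGrp 𝒞
  mul_assoc : ∀ a b c, mul (mul a b) c = mul a (mul b c)
  mul_comm : ∀ a b, mul a b = mul b a
  one_mul : ∀ a, mul one a = a
  inv_mul : ∀ a, mul (inv a) a = one
  mul_spec : ∀ (M N : {M : GSupMod k ι // IsEndotrivial 𝒞 M}) (T : GSupMod k ι)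
      (_ : IsTensorObj M.1 N.1 T) (hT : IsEndotrivial 𝒞 T),
      mul (tmk 𝒞 M) (tmk 𝒞 N) = tmk 𝒞 ⟨T, hT⟩
  one_spec : ∀ (K : GSupMod k ι) (_ : IsTrivial false K) (hK : IsEndotrivial 𝒞 K),
      one = tmk 𝒞 ⟨K, hK⟩
  inv_spec : ∀ (M : {M : GSupMod k ι // IsEndotrivial 𝒞 M}) (D : GSupMod k ι)
      (_ : IsDualObj M.1 D) (hD : IsEndotrivial 𝒞 D),
      inv (tmk 𝒞 M) = tmk 𝒞 ⟨D, hD⟩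

end SupCat

namespace SupCat

open GSupMod

variable {k : Type} [Field k]

/-- The category `F(e_r) = F_(e_r, (e_r)₀)` of finite-dimensional supermodules
over the rank `r` detecting subalgebra `e_r = q(1) × ⋯ × q(1)` which are
completely reducible over the even part.  The odd basis elements `e_i`
pairwise anticommute for `i ≠ j` (the only nontrivial brackets being
`[e_i, e_i] = 2t_i`, so that `t_i` acts as `θ i ∘ θ i`), and complete
reducibility over the torus `(e_r)₀ = ⟨t_1, …, t_r⟩` says that every
submodule invariant under all the `t_i` has an invariant complement. -/
def ECat (k : Type) [Field k] (r : ℕ) : GSupMod k (Fin r) → Prop := fun M =>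
  (∀ i j, i ≠ j → M.θ i ∘ₗ M.θ j + M.θ j ∘ₗ M.θ i = 0) ∧
  (∀ N : Submodule k M.carrier,
    (∀ i, ∀ m ∈ N, M.θ i (M.θ i m) ∈ N) →
    ∃ N' : Submodule k M.carrier,
      (∀ i, ∀ m ∈ N', M.θ i (M.θ i m) ∈ N') ∧ IsCompl N N')

/-- The action of the even toral element `t_i = [x_i, y_i]` on a supermodule
over `f_n = sl(1|1) × ⋯ × sl(1|1)`, whose odd generators are
`x_i = θ (inl i)` and `y_i = θ (inr i)`. -/
def fT {n : ℕ} (M : GSupMod k (Fin n ⊕ Fin n)) (i : Fin n) :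
    M.carrier →ₗ[k] M.carrier :=
  M.θ (Sum.inl i) ∘ₗ M.θ (Sum.inr i) + M.θ (Sum.inr i) ∘ₗ M.θ (Sum.inl i)

/-- The category `F(f_n) = F_(f_n, (f_n)₀)` of finite-dimensional supermodules
over the detecting subalgebra `f_n = sl(1|1) × ⋯ × sl(1|1)` (of rank `2n`)
which are completely reducible over the even part.  The odd generators
`x_i = θ (inl i)`, `y_i = θ (inr i)` pairwise anticommute except for
`[x_i, y_i] = t_i`, and complete reducibility over the torus
`(f_n)₀ = ⟨t_1, …, t_n⟩` says that every submodule invariant under all the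
`t_i` has an invariant complement. -/
def FCat (k : Type) [Field k] (n : ℕ) :
    GSupMod k (Fin n ⊕ Fin n) → Prop := fun M =>
  (∀ i j, M.θ (Sum.inl i) ∘ₗ M.θ (Sum.inl j)
      + M.θ (Sum.inl j) ∘ₗ M.θ (Sum.inl i) = 0) ∧
  (∀ i j, M.θ (Sum.inr i) ∘ₗ M.θ (Sum.inr j)
      + M.θ (Sum.inr j) ∘ₗ M.θ (Sum.inr i) = 0) ∧
  (∀ i j, i ≠ j → M.θ (Sum.inl i) ∘ₗ M.θ (Sum.inr j)
      + M.θ (Sum.inr j) ∘ₗ M.θ (Sum.inl i) = 0) ∧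
  (∀ N : Submodule k M.carrier,
    (∀ i, ∀ m ∈ N, fT M i m ∈ N) →
    ∃ N' : Submodule k M.carrier,
      (∀ i, ∀ m ∈ N', fT M i m ∈ N') ∧ IsCompl N N')

end SupCat

namespace SupCat
namespace GSupMod

variable {k : Type} [Field k] {ι : Type}

theorem sigma_ev (M : GSupMod k ι) {m : M.carrier} (hm : m ∈ M.ev) : M.sigma m = m := by
  have h1 := Submodule.linearProjOfIsCompl_apply_left M.isCompl ⟨m, hm⟩
  have h2 := Submodule.linearProjOfIsCompl_apply_right M.isCompl.symm ⟨m, hm⟩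
  simp only at h1 h2
  change ((Submodule.linearProjOfIsCompl M.ev M.od M.isCompl m : M.ev) : M.carrier)
    - ((Submodule.linearProjOfIsCompl M.od M.ev M.isCompl.symm m : M.od) : M.carrier) = _
  simp [Submodule.linearProjOfIsCompl, h1, h2]

theorem sigma_od (M : GSupMod k ι) {m : M.carrier} (hm : m ∈ M.od) : M.sigma m = -m := by
  have h1 := Submodule.linearProjOfIsCompl_apply_left M.isCompl.symm ⟨m, hm⟩
  have h2 := Submodule.linearProjOfIsCompl_apply_right M.isCompl ⟨m, hm⟩
  simp only at h1 h2
  change ((Submodule.linearProjOfIsCompl M.ev M.od M.isCompl m : M.ev) : M.carrier)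
    - ((Submodule.linearProjOfIsCompl M.od M.ev M.isCompl.symm m : M.od) : M.carrier) = _
  simp [Submodule.linearProjOfIsCompl, h1, h2]

theorem exists_add (M : GSupMod k ι) (m : M.carrier) :
    ∃ a ∈ M.ev, ∃ b ∈ M.od, a + b = m := by
  have : m ∈ M.ev ⊔ M.od := by rw [M.isCompl.sup_eq_top]; trivial
  exact Submodule.mem_sup.1 this

theorem eq_zero_of (M : GSupMod k ι) {m : M.carrier} (h : m ∈ M.ev) (h' : m ∈ M.od) : m = 0 :=
  Submodule.disjoint_def.1 M.isCompl.disjoint m h h'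

theorem add_eq_zero_of (M : GSupMod k ι) {a b : M.carrier} (h : a ∈ M.ev) (h' : b ∈ M.od)
    (hab : a + b = 0) : a = 0 ∧ b = 0 := by
  have hb : b = -a := (neg_eq_of_add_eq_zero_right hab).symm
  have : b = 0 := M.eq_zero_of (by rw [hb]; exact M.ev.neg_mem h) h'
  subst this
  simpa using hab

theorem sigma_sq (M : GSupMod k ι) : M.sigma * M.sigma = 1 := by
  ext m
  obtain ⟨a, ha, b, hb, rfl⟩ := M.exists_add m
  simp [M.sigma_ev ha, M.sigma_od hb]

theorem sigma_theta (M : GSupMod k ι) (i : ι) : M.sigma * M.θ i = - (M.θ i * M.sigma) := by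
  ext m
  obtain ⟨a, ha, b, hb, rfl⟩ := M.exists_add m
  simp [M.sigma_ev ha, M.sigma_od hb, M.sigma_od (M.θ_ev i a ha), M.sigma_ev (M.θ_od i b hb),
    add_comm]

/-- graded invariant submodule as a supermodule -/
def subMod (M : GSupMod k ι) (N : Submodule k M.carrier)
    (hN : ∀ i, ∀ m ∈ N, M.θ i m ∈ N)
    (hg : ∀ a ∈ M.ev, ∀ b ∈ M.od, a + b ∈ N → a ∈ N ∧ b ∈ N) : GSupMod k ι where
  carrier := N
  ev := M.ev.comap N.subtype
  od := M.od.comap N.subtype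
  isCompl := by
    constructor
    · rw [Submodule.disjoint_def]
      intro x h1 h2
      exact Subtype.ext (M.eq_zero_of h1 h2)
    · rw [codisjoint_iff, eq_top_iff]
      rintro ⟨x, hx⟩ -
      obtain ⟨a, ha, b, hb, rfl⟩ := M.exists_add x
      obtain ⟨h1, h2⟩ := hg a ha b hb hx
      exact Submodule.mem_sup.2 ⟨⟨a, h1⟩, ha, ⟨b, h2⟩, hb, rfl⟩
  θ := fun i => (M.θ i).restrict (hN i)
  θ_ev := fun i m hm => M.θ_ev i m.1 hm
  θ_od := fun i m hm => M.θ_od i m.1 hm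

theorem indec_split (M : GSupMod k ι) (hM : Indecomposable M) (A B : Submodule k M.carrier)
    (hAB : IsCompl A B)
    (hA : ∀ i, ∀ m ∈ A, M.θ i m ∈ A)
    (hgA : ∀ a ∈ M.ev, ∀ b ∈ M.od, a + b ∈ A → a ∈ A ∧ b ∈ A)
    (hB : ∀ i, ∀ m ∈ B, M.θ i m ∈ B)
    (hgB : ∀ a ∈ M.ev, ∀ b ∈ M.od, a + b ∈ B → a ∈ B ∧ b ∈ B) :
    A = ⊥ ∨ B = ⊥ := by
  have key : IsDsum (M.subMod A hA hgA) (M.subMod B hB hgB) M := by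
    let e := Submodule.prodEquivOfIsCompl A B hAB
    have hgr : ∀ (p : A × B) , (e p ∈ M.ev ↔ (p.1 : M.carrier) ∈ M.ev ∧ (p.2 : M.carrier) ∈ M.ev) ∧
        (e p ∈ M.od ↔ (p.1 : M.carrier) ∈ M.od ∧ (p.2 : M.carrier) ∈ M.od) := by
      rintro ⟨⟨a, ha⟩, ⟨b, hb⟩⟩
      have he : e (⟨a, ha⟩, ⟨b, hb⟩) = a + b := by simp [e]
      rw [he]
      obtain ⟨a0, ha0, a1, ha1, rfl⟩ := M.exists_add a
      obtain ⟨b0, hb0, b1, hb1, rfl⟩ := M.exists_add b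
      obtain ⟨hA0, hA1⟩ := hgA _ ha0 _ ha1 ha
      obtain ⟨hB0, hB1⟩ := hgB _ hb0 _ hb1 hb
      have dis : ∀ x ∈ A, ∀ y ∈ B, x + y = 0 → x = 0 ∧ y = 0 := by
        intro x hx y hy hxy
        have hy' : y = -x := (neg_eq_of_add_eq_zero_right hxy).symm
        have : y = 0 := Submodule.disjoint_def.1 hAB.disjoint y
          (by rw [hy']; exact A.neg_mem hx) hy
        subst this
        simpa using hxy
      constructor
      · refine ⟨fun h => ?_, fun h => M.ev.add_mem h.1 h.2⟩
        have h' : a1 + b1 ∈ M.ev := by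
          have := M.ev.sub_mem h (M.ev.add_mem ha0 hb0)
          convert this using 1; abel
        have := M.eq_zero_of h' (M.od.add_mem ha1 hb1)
        obtain ⟨rfl, rfl⟩ := dis _ hA1 _ hB1 this
        simpa using ⟨ha0, hb0⟩
      · refine ⟨fun h => ?_, fun h => M.od.add_mem h.1 h.2⟩
        have h' : a0 + b0 ∈ M.od := by
          have := M.od.sub_mem h (M.od.add_mem ha1 hb1)
          convert this using 1; abel
        have := M.eq_zero_of (M.ev.add_mem ha0 hb0) h'
        obtain ⟨rfl, rfl⟩ := dis _ hA0 _ hB0 this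
        simpa using ⟨ha1, hb1⟩
    refine ⟨e.symm, ?_, ?_, ?_⟩
    · intro s
      obtain ⟨p, rfl⟩ := e.surjective s
      have hp : e.symm (e p) = p := e.symm_apply_apply p
      have := (hgr p).1
      erw [hp]
      exact this
    · intro s
      obtain ⟨p, rfl⟩ := e.surjective s
      have hp : e.symm (e p) = p := e.symm_apply_apply p
      have := (hgr p).2
      erw [hp]
      exact this
    · intro i s
      obtain ⟨p, rfl⟩ := e.surjective s
      erw [e.symm_apply_apply]
      apply e.injective
      erw [e.apply_symm_apply]
      have he : ∀ q : A × B, e q = (q.1 : M.carrier) + q.2 := fun q => by simp [e]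
      refine Eq.trans ?_ (he _).symm
      rw [he, map_add]
      rfl
  rcases hM.2 _ _ key with h | h
  · left
    rw [eq_bot_iff]
    intro x hx
    exact congrArg Subtype.val (h ⟨x, hx⟩)
  · right
    rw [eq_bot_iff]
    intro x hx
    exact congrArg Subtype.val (h ⟨x, hx⟩)

theorem indec_op (M : GSupMod k ι) (hM : Indecomposable M) (T : Module.End k M.carrier)
    (hT : ∀ i, T * M.θ i = M.θ i * T)
    (hev : ∀ m ∈ M.ev, T m ∈ M.ev) (hod : ∀ m ∈ M.od, T m ∈ M.od)
    (N' : Submodule k M.carrier) (hN' : ∀ m ∈ N', T m ∈ N')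
    (hc : IsCompl (LinearMap.ker T) N') : IsUnit T ∨ T = 0 := by
  have hc' : ∀ i m, T (M.θ i m) = M.θ i (T m) := fun i m => LinearMap.congr_fun (hT i) m
  have hinj : Function.Injective (T.restrict hN') := by
    rw [injective_iff_map_eq_zero]
    rintro ⟨x, hx⟩ h
    have : T x = 0 := congrArg Subtype.val h
    exact Subtype.ext (Submodule.disjoint_def.1 hc.disjoint x this hx)
  have hsurj := LinearMap.injective_iff_surjective.1 hinj
  have hr : LinearMap.range T = N' := by
    apply le_antisymm
    · rintro _ ⟨m, rfl⟩
      have : m ∈ LinearMap.ker T ⊔ N' := by rw [hc.sup_eq_top]; trivial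
      obtain ⟨a, ha, b, hb, rfl⟩ := Submodule.mem_sup.1 this
      rw [map_add, LinearMap.mem_ker.1 ha, zero_add]
      exact hN' b hb
    · intro x hx
      obtain ⟨y, hy⟩ := hsurj ⟨x, hx⟩
      exact ⟨y.1, congrArg Subtype.val hy⟩
  rw [← hr] at hc
  have key : LinearMap.ker T = ⊥ ∨ LinearMap.range T = ⊥ := by
    refine M.indec_split hM _ _ hc ?_ ?_ ?_ ?_
    · intro i m hm
      rw [LinearMap.mem_ker] at *
      rw [hc', hm, map_zero]
    · intro a ha b hb hab
      rw [LinearMap.mem_ker, map_add] at hab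
      exact M.add_eq_zero_of (hev a ha) (hod b hb) hab
    · rintro i _ ⟨m, rfl⟩
      exact ⟨M.θ i m, hc' i m⟩
    · rintro a ha b hb ⟨m, hm⟩
      obtain ⟨c, hc, d, hd, rfl⟩ := M.exists_add m
      rw [map_add] at hm
      have : (T c - a) + (T d - b) = 0 := by
        rw [← sub_eq_zero.2 hm]; abel
      obtain ⟨h1, h2⟩ := M.add_eq_zero_of (M.ev.sub_mem (hev c hc) ha)
        (M.od.sub_mem (hod d hd) hb) this
      exact ⟨⟨c, sub_eq_zero.1 h1⟩, ⟨d, sub_eq_zero.1 h2⟩⟩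
  rcases key with h | h
  · left
    exact (LinearMap.isUnit_iff_ker_eq_bot T).2 h
  · right
    exact LinearMap.range_eq_bot.1 h

theorem isUnit_of_mul_self_isUnit {V : Type} [AddCommGroup V] [Module k V] {f : Module.End k V}
    (h : IsUnit (f * f)) : IsUnit f :=
  ((Commute.refl f).isUnit_mul_iff.1 h).1

theorem eq_zero_of_add_self [CharZero k] {V : Type} [AddCommGroup V] [Module k V] {f : V}
    (h : f + f = 0) : f = 0 := by
  rw [← two_smul k] at h
  exact (smul_eq_zero.1 h).resolve_left two_ne_zero

theorem not_unit [CharZero k] [Fintype ι] (𝒞 : GSupMod k ι → Prop) (M : GSupMod k ι)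
    (hM : IsEndotrivial 𝒞 M) (v : ι → k) :
    ¬ IsUnit (show Module.End k M.carrier from M.actOf v) := by
  intro hu
  obtain ⟨-, H, K, P, S, ⟨φ, -, -, hφ⟩, -, hK, -, ⟨ψ, -, -, hψ⟩, ⟨e, he, -, -⟩⟩ := hM
  set Θ : Module.End k M.carrier := M.actOf v with hΘ
  let σ : Module.End k M.carrier := M.sigma
  have hσ2 : σ * σ = 1 := M.sigma_sq
  have hσΘ : σ * Θ = -(Θ * σ) := by
    have : Θ = ∑ i, v i • (show Module.End k M.carrier from M.θ i) := rfl
    rw [this, Finset.mul_sum, Finset.sum_mul, ← Finset.sum_neg_distrib]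
    refine Finset.sum_congr rfl fun i _ => ?_
    rw [mul_smul_comm, smul_mul_assoc, ← smul_neg]
    congr 1
    exact M.sigma_theta i
  obtain ⟨w, hw1, hw2⟩ : ∃ w : Module.End k M.carrier, Θ * w = 1 ∧ w * Θ = 1 :=
    ⟨_, hu.mul_val_inv, hu.val_inv_mul⟩
  have hσw : σ * w = -(w * σ) := by
    calc σ * w = (w * Θ) * σ * w := by rw [hw2, one_mul]
      _ = w * (Θ * σ) * w := by simp only [mul_assoc]
      _ = w * (-(σ * Θ)) * w := by rw [hσΘ, neg_neg]
      _ = -(w * σ * (Θ * w)) := by simp only [mul_assoc, mul_neg, neg_mul]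
      _ = _ := by rw [hw1, mul_one]
  have hφ' : ∀ h, φ (H.actOf v h) =
      (Θ * (show Module.End k M.carrier from φ h) - σ * (show Module.End k M.carrier from φ h) * σ * Θ) := by
    intro h
    have h1 : φ (H.actOf v h) = ∑ i, v i • φ (H.θ i h) := by
      simp [actOf]
    rw [h1]
    simp only [hφ]
    ext m
    simp [hΘ, σ, actOf, smul_sub, Finset.sum_sub_distrib]
  obtain ⟨x, hx⟩ : ∃ x : K.carrier, x ≠ 0 := by
    have : 0 < Module.finrank k K.carrier := by rw [hK.1]; norm_num
    haveI := Module.finrank_pos_iff.1 this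
    exact exists_ne 0
  have heS : ∀ h, e (H.actOf v h) = S.actOf v (e h) := by
    intro h
    have : ∀ i, e (H.θ i h) = S.θ i (e h) := fun i => LinearMap.congr_fun (he i) h
    simp [actOf, this]
  have hψS : ∀ s, ψ (S.actOf v s) = (0, P.actOf v (ψ s).2) := by
    intro s
    have h1 : ψ (S.actOf v s) = ∑ i, v i • ψ (S.θ i s) := by simp [actOf]
    rw [h1]
    simp only [hψ, LinearMap.prodMap_apply, hK.2.1]
    ext <;> simp [actOf, Prod.fst_sum, Prod.snd_sum]
  let h := e.symm (ψ.symm (x, 0))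
  have hψh : ψ (e h) = (x, 0) := by simp [h]
  have hh : H.actOf v h = 0 := by
    apply e.injective
    apply ψ.injective
    rw [heS, hψS, hψh]
    simp
  let g : Module.End k M.carrier := φ h
  have hg : Θ * g - σ * g * σ * Θ = 0 := by
    rw [← hφ' h, hh, map_zero]
  let h' := φ.symm ((2⁻¹ : k) • (w * g))
  have hh' : H.actOf v h' = h := by
    apply φ.injective
    rw [hφ']
    have : φ h' = (2⁻¹ : k) • (w * g) := by simp [h']
    rw [this]
    change Θ * ((2⁻¹ : k) • (w * g)) - σ * ((2⁻¹ : k) • (w * g)) * σ * Θ = g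
    simp only [mul_smul_comm, smul_mul_assoc]
    have e1 : Θ * (w * g) = g := by rw [← mul_assoc, hw1, one_mul]
    have e2 : σ * (w * g) * σ * Θ = -g := by
      calc σ * (w * g) * σ * Θ = (σ * w) * g * σ * Θ := by simp only [mul_assoc]
        _ = -(w * (σ * g * σ * Θ)) := by rw [hσw]; simp only [mul_assoc, neg_mul]
        _ = -(w * (Θ * g)) := by rw [sub_eq_zero.1 hg]
        _ = -g := by rw [← mul_assoc, hw2, one_mul]
    rw [e1, e2, smul_neg, sub_neg_eq_add, ← add_smul]
    have : (2⁻¹ + 2⁻¹ : k) = 1 := by norm_num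
    rw [this, one_smul]
  have := hψS (e h')
  rw [← heS, hh', hψh] at this
  exact hx (congrArg Prod.fst this)

end GSupMod
end SupCat

open SupCat SupCat.GSupMod in
/-- Let `a` be a detecting subalgebra (either
`e_r = q(1)^{×r}` or `f_n = sl(1|1)^{×n}`) and `M` an indecomposable
`a`-supermodule.  If `M` is endotrivial, then `M` lies in the principal
block; that is, all even elements of `a` (equivalently, all the toral
elements `t_i`) act on `M` by zero. -/
theorem indecomposable_endotrivial_in_principal_block
    (k : Type) [Field k] [IsAlgClosed k] [CharZero k] :
    (∀ (r : ℕ) (M : GSupMod k (Fin r)), ECat k r M → Indecomposable M →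
      IsEndotrivial (ECat k r) M →
      ∀ i, M.θ i ∘ₗ M.θ i = 0) ∧
    (∀ (n : ℕ) (M : GSupMod k (Fin n ⊕ Fin n)), FCat k n M →
      Indecomposable M → IsEndotrivial (FCat k n) M →
      ∀ i, fT M i = 0) := by
  constructor
  · intro r M hC hI hE i
    obtain ⟨hac, hcr⟩ := hC
    have hcomm : ∀ a b, (M.θ a * M.θ a) * M.θ b = M.θ b * (M.θ a * M.θ a) := by
      intro a b
      by_cases hab : a = b
      · subst hab; rw [mul_assoc]
      · have h : M.θ a * M.θ b = -(M.θ b * M.θ a) := eq_neg_of_add_eq_zero_left (hac a b hab)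
        rw [mul_assoc, h, mul_neg, ← mul_assoc, h, neg_mul, neg_neg, mul_assoc]
    have hcomm' : ∀ a b m, M.θ a (M.θ a (M.θ b m)) = M.θ b (M.θ a (M.θ a m)) :=
      fun a b m => LinearMap.congr_fun (hcomm a b) m
    obtain ⟨N', hN', hcompl⟩ := hcr (LinearMap.ker (M.θ i * M.θ i)) (by
      intro j m hm
      rw [LinearMap.mem_ker, Module.End.mul_apply] at *
      rw [hcomm', hcomm', hm, map_zero, map_zero])
    rcases M.indec_op hI (M.θ i * M.θ i) (hcomm i)
      (fun m hm => M.θ_od i _ (M.θ_ev i m hm)) (fun m hm => M.θ_ev i _ (M.θ_od i m hm))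
      N' (hN' i) hcompl with h | h
    · exfalso
      apply M.not_unit _ hE (Pi.single i 1)
      have : M.actOf (Pi.single i 1) = M.θ i := by
        simp [actOf, Pi.single_apply]
      rw [this]
      exact isUnit_of_mul_self_isUnit h
    · exact h
  · intro n M hC hI hE i
    obtain ⟨hxx, hyy, hxy, hcr⟩ := hC
    have hx2 : ∀ a, M.θ (Sum.inl a) * M.θ (Sum.inl a) = 0 := by
      intro a
      have := hxx a a
      exact eq_zero_of_add_self (k := k) this
    have hy2 : ∀ a, M.θ (Sum.inr a) * M.θ (Sum.inr a) = 0 := by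
      intro a
      have := hyy a a
      exact eq_zero_of_add_self (k := k) this
    have hfT : ∀ a, fT M a = M.θ (Sum.inl a) * M.θ (Sum.inr a)
      + M.θ (Sum.inr a) * M.θ (Sum.inl a) := fun a => rfl
    have anti : ∀ p q r : Module.End k M.carrier, p * r = -(r * p) → q * r = -(r * q) →
        (p * q + q * p) * r = r * (p * q + q * p) := by
      intro p q r h1 h2
      rw [add_mul, mul_add, mul_assoc, mul_assoc, h1, h2, mul_neg, mul_neg, ← mul_assoc,
        ← mul_assoc, h1, h2]
      simp only [neg_mul, neg_neg, mul_assoc]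
    have hcomm : ∀ a b, fT M a * M.θ b = M.θ b * fT M a := by
      intro a b
      rw [hfT]
      rcases b with b | b
      · by_cases hab : a = b
        · subst hab
          rw [add_mul, mul_add, mul_assoc _ (M.θ (Sum.inl a)) (M.θ (Sum.inl a)), hx2,
            ← mul_assoc (M.θ (Sum.inl a)) (M.θ (Sum.inl a)), hx2]
          simp [mul_assoc]
        · exact anti _ _ _ (eq_neg_of_add_eq_zero_left (hxx a b))
            (eq_neg_of_add_eq_zero_right (hxy b a (Ne.symm hab)))
      · by_cases hab : a = b
        · subst hab
          rw [add_mul, mul_add, mul_assoc _ (M.θ (Sum.inr a)) (M.θ (Sum.inr a)), hy2,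
            ← mul_assoc (M.θ (Sum.inr a)) (M.θ (Sum.inr a)), hy2]
          simp [mul_assoc]
        · exact anti _ _ _ (eq_neg_of_add_eq_zero_left (hxy a b hab))
            (eq_neg_of_add_eq_zero_left (hyy a b))
    have hcc : ∀ a b, fT M a * fT M b = fT M b * fT M a := by
      intro a b
      rw [hfT b, mul_add, add_mul, ← mul_assoc, ← mul_assoc, hcomm, hcomm, mul_assoc, mul_assoc,
        hcomm, hcomm, mul_assoc, mul_assoc]
    obtain ⟨N', hN', hcompl⟩ := hcr (LinearMap.ker (fT M i)) (by
      intro j m hm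
      rw [LinearMap.mem_ker] at *
      have := LinearMap.congr_fun (hcc i j) m
      rw [Module.End.mul_apply, Module.End.mul_apply, hm, map_zero] at this
      exact this)
    rcases M.indec_op hI (fT M i) (hcomm i)
      (fun m hm => M.ev.add_mem (M.θ_od _ _ (M.θ_ev _ m hm)) (M.θ_od _ _ (M.θ_ev _ m hm)))
      (fun m hm => M.od.add_mem (M.θ_ev _ _ (M.θ_od _ m hm)) (M.θ_ev _ _ (M.θ_od _ m hm)))
      N' (hN' i) hcompl with h | h
    · exfalso
      apply M.not_unit _ hE (Pi.single (Sum.inl i) 1 + Pi.single (Sum.inr i) 1)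
      have : M.actOf (Pi.single (Sum.inl i) 1 + Pi.single (Sum.inr i) 1)
          = M.θ (Sum.inl i) + M.θ (Sum.inr i) := by
        simp [actOf, Pi.single_apply]
      rw [this]
      apply isUnit_of_mul_self_isUnit
      have h2 : (M.θ (Sum.inl i) + M.θ (Sum.inr i)) * (M.θ (Sum.inl i) + M.θ (Sum.inr i))
          = fT M i := by
        rw [hfT, add_mul, mul_add, mul_add, hx2, hy2]; simp
      rw [h2]
      exact h
    · exact h
end
end

section
/- Let M be a V(a_2)-supermodule with no projective submodules satisfying condition (2). Let a be a nonzero element of (a_2)_1, b a nonzero element of (a_2)_1 not in the span of a, and let v be a generator of the Ω^t(k|_⟨a⟩) component in some decomposition of M|_⟨a⟩. Then M satisfies condition (1) if and only if every such element v satisfies b.v ≠ 0. -/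
/-!
A concrete model of the supermodule categories of the paper "On Endotrivial
Modules for Lie Superalgebras" attached to the detecting subalgebras
`e_r = q(1)^{×r}`, `f_n = sl(1|1)^{×n}`, to rank-one subalgebras `⟨z⟩` of
`sl(1|1)`, and to the exterior superalgebras `V(a_r) = Λ((a_r)₁)`.

A `GSupMod k ι` is a finite-dimensional `ℤ₂`-graded `k`-vector space together
with a family of odd operators `θ i` (the actions of the distinguished odd
basis elements of the superalgebra: the `e_i` for `e_r`, the `x_i, y_i` for
`f_n`, the `a_i` for `V(a_r)`).  The even parts of all these superalgebras are
generated by the brackets of the odd generators, so the relations defining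
each particular category, as well as complete reducibility over the even part,
are imposed by a predicate `𝒞 : GSupMod k ι → Prop`, defined separately for
each case.  All categorical notions (homomorphisms, isomorphisms, direct sums,
tensor products, duals, internal Hom, trivial modules, projectivity,
projective covers and injective hulls, syzygies `Ωⁿ` for `n : ℤ`, endotrivial
modules, and the group `T` of stable classes of endotrivial modules) are
defined relative to such a predicate.
-/

noncomputable section

namespace SupCat

open GSupMod Submodule

variable {k : Type} [Field k]

/-- `v` is a generator of the `Ω^t(k|⟨a⟩)` component of some decomposition
`M|⟨a⟩ ≅ Ω^t(k|⟨a⟩) ⊕ P` (`t ∈ {0,1}`) of the restriction of `M` to the rank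
one subalgebra `⟨a⟩` generated by the nonzero odd element `a`, where `P` is a
projective `⟨a⟩`-supermodule.  Over `⟨a⟩` (an exterior algebra on one odd
generator) the component `Ω^t(k|⟨a⟩)` is one-dimensional and trivial, so a
generator of it is a spanning vector `v` killed by `a`; and a finite
dimensional `⟨a⟩`-module is projective (= free) precisely when the kernel of
`a` on it coincides with the image of `a`. -/
def IsOmegaComponentGen (M : GSupMod k (Fin 2)) (a : Fin 2 → k)
    (v : M.carrier) : Prop :=
  v ≠ 0 ∧
  ∃ L P : Submodule k M.carrier,
    IsCompl L P ∧
    L = Submodule.span k {v} ∧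
    L = (L ⊓ M.ev) ⊔ (L ⊓ M.od) ∧
    P = (P ⊓ M.ev) ⊔ (P ⊓ M.od) ∧
    actOf M a v = 0 ∧
    P ⊓ LinearMap.ker (actOf M a) = Submodule.map (actOf M a) P

/-- Condition (1): `Rk(M) > Rk(Ω⁻¹(M))`, where `Rk(M) = dim_k M/Rad(M)`. -/
def Cond1 (M : GSupMod k (Fin 2)) : Prop :=
  ∀ N : GSupMod k (Fin 2), IsCosyzygy (VCat k 2) M N → rk N < rk M

/-- Condition (2): for every nonzero `a = c₁a₁ + c₂a₂ ∈ (a₂)₁`,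
`M|⟨a⟩ ≅ Ω^t(k|⟨a⟩) ⊕ P` where `t ∈ {0,1}`, `P` is a projective
`⟨a⟩`-supermodule, and `k` is the trivial module (of either parity). -/
def Cond2 (M : GSupMod k (Fin 2)) : Prop :=
  ∀ a : Fin 2 → k, a ≠ 0 →
    ∃ (p : Bool) (t : Fin 2) (K T P R : GSupMod k (Fin 1)),
      IsTrivial p K ∧
      ((t = 0 ∧ Iso K T) ∨ (t = 1 ∧ IsSyzygy (VCat k 1) K T)) ∧
      IsProjective (VCat k 1) P ∧
      IsRestriction ![a] M R ∧
      IsDsum T P R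

/-- Condition (3): `M` satisfies (2); every generator `v` of the
`Ω^t(k|⟨a⟩)` component of `M|⟨a⟩` is a generator of `M` (i.e. `v ∉ Rad M`);
and for any generator `m` of `M`, either `a.m ≠ 0` or `b.m ≠ 0`, where `b` is
a nonzero element of `(a₂)₁` not in the span of `a`. -/
def Cond3 (M : GSupMod k (Fin 2)) : Prop :=
  Cond2 M ∧
  ∀ a : Fin 2 → k, a ≠ 0 →
    (∀ v : M.carrier, IsOmegaComponentGen M a v → v ∉ radical M) ∧
    (∀ b : Fin 2 → k, b ∉ Submodule.span k {a} →
      ∀ m : M.carrier, m ∉ radical M →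
        actOf M a m ≠ 0 ∨ actOf M b m ≠ 0)

end SupCat

namespace SupCatAux

open SupCat SupCat.GSupMod

variable {k : Type} [Field k] {ι : Type}

theorem isCompl_of {V : Type} [AddCommGroup V] [Module k V] {E O : Submodule k V}
    (h1 : ∀ x, x ∈ E → x ∈ O → x = 0) (h2 : ∀ x, ∃ e ∈ E, ∃ o ∈ O, e + o = x) :
    IsCompl E O := by
  constructor
  · rw [Submodule.disjoint_def]; exact h1
  · rw [codisjoint_iff, Submodule.eq_top_iff']
    intro x
    rw [Submodule.mem_sup]
    exact h2 x

/-- even projection -/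
def eP (M : GSupMod k ι) : M.carrier →ₗ[k] M.carrier := M.ev.projection M.od M.isCompl

/-- odd projection -/
def oP (M : GSupMod k ι) : M.carrier →ₗ[k] M.carrier := M.od.projection M.ev M.isCompl.symm

theorem eP_mem (M : GSupMod k ι) (x : M.carrier) : eP M x ∈ M.ev :=
  Submodule.projection_apply_mem _ _

theorem oP_mem (M : GSupMod k ι) (x : M.carrier) : oP M x ∈ M.od :=
  Submodule.projection_apply_mem _ _

theorem eP_ev (M : GSupMod k ι) {x : M.carrier} (h : x ∈ M.ev) : eP M x = x :=
  Submodule.projection_apply_of_mem_left _ h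

theorem oP_od (M : GSupMod k ι) {x : M.carrier} (h : x ∈ M.od) : oP M x = x :=
  Submodule.projection_apply_of_mem_left _ h

theorem eP_od (M : GSupMod k ι) {x : M.carrier} (h : x ∈ M.od) : eP M x = 0 :=
  (Submodule.projection_apply_eq_zero_iff _).2 h

theorem oP_ev (M : GSupMod k ι) {x : M.carrier} (h : x ∈ M.ev) : oP M x = 0 :=
  (Submodule.projection_apply_eq_zero_iff _).2 h

theorem eP_add_oP (M : GSupMod k ι) (x : M.carrier) : eP M x + oP M x = x := by
  obtain ⟨e, he, o, ho, rfl⟩ := Submodule.mem_sup.1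
    (show x ∈ M.ev ⊔ M.od by rw [M.isCompl.sup_eq_top]; trivial)
  simp [eP_ev M he, oP_od M ho, eP_od M ho, oP_ev M he]

theorem mem_zero (M : GSupMod k ι) {x : M.carrier} (h1 : x ∈ M.ev) (h2 : x ∈ M.od) : x = 0 := by
  rw [← eP_ev M h1, eP_od M h2]

/-- parity preserving -/
def Gr (M N : GSupMod k ι) (f : M.carrier →ₗ[k] N.carrier) : Prop :=
  (∀ m ∈ M.ev, f m ∈ N.ev) ∧ (∀ m ∈ M.od, f m ∈ N.od)

theorem Gr.eP {M N : GSupMod k ι} {f : M.carrier →ₗ[k] N.carrier} (h : Gr M N f)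
    (x : M.carrier) : f (eP M x) = SupCatAux.eP N (f x) := by
  conv_rhs => rw [← eP_add_oP M x]
  rw [map_add, map_add, eP_ev N (h.1 _ (eP_mem M x)), eP_od N (h.2 _ (oP_mem M x)), add_zero]

theorem Gr.oP {M N : GSupMod k ι} {f : M.carrier →ₗ[k] N.carrier} (h : Gr M N f)
    (x : M.carrier) : f (oP M x) = SupCatAux.oP N (f x) := by
  conv_rhs => rw [← eP_add_oP M x]
  rw [map_add, map_add, oP_ev N (h.1 _ (eP_mem M x)), oP_od N (h.2 _ (oP_mem M x)), zero_add]

/-- the parity preserving part of a linear map -/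
def gr (M N : GSupMod k ι) (f : M.carrier →ₗ[k] N.carrier) : M.carrier →ₗ[k] N.carrier :=
  eP N ∘ₗ f ∘ₗ eP M + oP N ∘ₗ f ∘ₗ oP M

theorem gr_Gr (M N : GSupMod k ι) (f : M.carrier →ₗ[k] N.carrier) : Gr M N (gr M N f) := by
  constructor
  · intro m hm
    simp [gr, oP_ev M hm, eP_mem]
  · intro m hm
    simp [gr, eP_od M hm, oP_mem]

theorem exists_section {M N : GSupMod k ι} {π : M.carrier →ₗ[k] N.carrier} (h : Gr M N π)
    (hs : Function.Surjective π) :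
    ∃ s : N.carrier →ₗ[k] M.carrier, Gr N M s ∧ ∀ y, π (s y) = y := by
  obtain ⟨s, hs⟩ := π.exists_rightInverse_of_surjective (LinearMap.range_eq_top.2 hs)
  refine ⟨gr N M s, gr_Gr _ _ _, fun y => ?_⟩
  have hs' : ∀ y, π (s y) = y := fun y => LinearMap.congr_fun hs y
  simp [gr, h.eP, h.oP, hs', eP_ev N (eP_mem N y), oP_od N (oP_mem N y), eP_add_oP]

theorem exists_retraction {M N : GSupMod k ι} {j : M.carrier →ₗ[k] N.carrier} (h : Gr M N j)
    (hj : Function.Injective j) :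
    ∃ r : N.carrier →ₗ[k] M.carrier, Gr N M r ∧ ∀ x, r (j x) = x := by
  obtain ⟨s, hs⟩ := j.exists_leftInverse_of_injective (LinearMap.ker_eq_bot.2 hj)
  refine ⟨gr N M s, gr_Gr _ _ _, fun y => ?_⟩
  have hs' : ∀ y, s (j y) = y := fun y => LinearMap.congr_fun hs y
  simp [gr, ← h.eP, ← h.oP, hs', eP_ev M (eP_mem M y), oP_od M (oP_mem M y), eP_add_oP]

theorem IsHom.Gr {M N : GSupMod k ι} {f : M.carrier →ₗ[k] N.carrier} (h : IsHom M N f) :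
    SupCatAux.Gr M N f := h.2

theorem IsHom.comm {M N : GSupMod k ι} {f : M.carrier →ₗ[k] N.carrier} (h : IsHom M N f)
    (i : ι) (x : M.carrier) : f (M.θ i x) = N.θ i (f x) := LinearMap.congr_fun (h.1 i) x

theorem IsHom.comp {M N Q : GSupMod k ι} {f : M.carrier →ₗ[k] N.carrier}
    {g : N.carrier →ₗ[k] Q.carrier} (hg : IsHom N Q g) (hf : IsHom M N f) :
    IsHom M Q (g ∘ₗ f) := by
  refine ⟨fun i => ?_, fun m hm => hg.2.1 _ (hf.2.1 _ hm), fun m hm => hg.2.2 _ (hf.2.2 _ hm)⟩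
  ext x
  simp [IsHom.comm hf, IsHom.comm hg]

/-- sub-supermodule -/
def subObj (M : GSupMod k ι) (N : Submodule k M.carrier) (hi : ∀ i, ∀ x ∈ N, M.θ i x ∈ N)
    (he : ∀ x ∈ N, eP M x ∈ N) : GSupMod k ι where
  carrier := N
  ev := M.ev.comap N.subtype
  od := M.od.comap N.subtype
  isCompl := by
    have ho : ∀ x ∈ N, oP M x ∈ N := fun x hx => by
      have := N.sub_mem hx (he x hx)
      rwa [sub_eq_of_eq_add' (eP_add_oP M x).symm] at this
    refine isCompl_of (fun x h1 h2 => Subtype.ext (mem_zero M h1 h2)) fun x => ?_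
    exact ⟨⟨_, he x x.2⟩, eP_mem M x, ⟨_, ho x x.2⟩, oP_mem M x, Subtype.ext (eP_add_oP M x)⟩
  θ i := (M.θ i).restrict (hi i)
  θ_ev i m hm := M.θ_ev i _ hm
  θ_od i m hm := M.θ_od i _ hm

theorem subObj_hom (M : GSupMod k ι) (N : Submodule k M.carrier) (hi he) :
    IsHom (subObj M N hi he) M N.subtype :=
  ⟨fun _ => rfl, fun _ h => h, fun _ h => h⟩

/-- quotient supermodule -/
def quotObj (M : GSupMod k ι) (N : Submodule k M.carrier) (hi : ∀ i, ∀ x ∈ N, M.θ i x ∈ N)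
    (he : ∀ x ∈ N, eP M x ∈ N) : GSupMod k ι where
  carrier := M.carrier ⧸ N
  ev := M.ev.map N.mkQ
  od := M.od.map N.mkQ
  isCompl := by
    refine isCompl_of ?_ fun x => ?_
    · rintro x ⟨e, hme, rfl⟩ ⟨o, hmo, ho⟩
      have h1 : e - o ∈ N := by
        rw [← Submodule.Quotient.mk_eq_zero, Submodule.Quotient.mk_sub, sub_eq_zero]
        exact ho.symm
      have := he _ h1
      rw [map_sub, eP_ev M hme, eP_od M hmo, sub_zero] at this
      simpa using this
    · obtain ⟨y, rfl⟩ := N.mkQ_surjective x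
      exact ⟨_, ⟨_, eP_mem M y, rfl⟩, _, ⟨_, oP_mem M y, rfl⟩, by
        rw [← map_add, eP_add_oP]⟩
  θ i := N.mapQ N (M.θ i) (hi i)
  θ_ev i := by
    rintro _ ⟨x, hx, rfl⟩
    exact ⟨_, M.θ_ev i _ hx, rfl⟩
  θ_od i := by
    rintro _ ⟨x, hx, rfl⟩
    exact ⟨_, M.θ_od i _ hx, rfl⟩

theorem quotObj_hom (M : GSupMod k ι) (N : Submodule k M.carrier) (hi he) :
    IsHom M (quotObj M N hi he) N.mkQ :=
  ⟨fun _ => rfl, fun x h => ⟨x, h, rfl⟩, fun x h => ⟨x, h, rfl⟩⟩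

theorem ker_hi {M N : GSupMod k ι} {f : M.carrier →ₗ[k] N.carrier} (h : IsHom M N f) :
    ∀ i, ∀ x ∈ LinearMap.ker f, M.θ i x ∈ LinearMap.ker f := by
  intro i x hx
  rw [LinearMap.mem_ker] at *
  rw [IsHom.comm h, hx, map_zero]

theorem ker_he {M N : GSupMod k ι} {f : M.carrier →ₗ[k] N.carrier} (h : IsHom M N f) :
    ∀ x ∈ LinearMap.ker f, eP M x ∈ LinearMap.ker f := by
  intro x hx
  rw [LinearMap.mem_ker] at *
  rw [(IsHom.Gr h).eP, hx, map_zero]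

theorem range_hi {M N : GSupMod k ι} {f : M.carrier →ₗ[k] N.carrier} (h : IsHom M N f) :
    ∀ i, ∀ x ∈ LinearMap.range f, N.θ i x ∈ LinearMap.range f := by
  rintro i _ ⟨x, rfl⟩
  exact ⟨_, IsHom.comm h i x⟩

theorem range_he {M N : GSupMod k ι} {f : M.carrier →ₗ[k] N.carrier} (h : IsHom M N f) :
    ∀ x ∈ LinearMap.range f, eP N x ∈ LinearMap.range f := by
  rintro _ ⟨x, rfl⟩
  exact ⟨_, (IsHom.Gr h).eP x⟩

theorem eP_θ (M : GSupMod k ι) (i : ι) (x : M.carrier) : eP M (M.θ i x) = M.θ i (oP M x) := by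
  conv_lhs => rw [← eP_add_oP M x]
  rw [map_add, map_add, eP_od M (M.θ_ev i _ (eP_mem M x)), eP_ev M (M.θ_od i _ (oP_mem M x)),
    zero_add]

theorem oP_θ (M : GSupMod k ι) (i : ι) (x : M.carrier) : oP M (M.θ i x) = M.θ i (eP M x) := by
  conv_lhs => rw [← eP_add_oP M x]
  rw [map_add, map_add, oP_od M (M.θ_ev i _ (eP_mem M x)), oP_ev M (M.θ_od i _ (oP_mem M x)),
    add_zero]

/-! ### the coinduced module over `V(a_2)` -/

/-- coinduced module -/
def coind (W : GSupMod k (Fin 2)) : GSupMod k (Fin 2) where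
  carrier := W.carrier × W.carrier × W.carrier × W.carrier
  ev := W.ev.prod (W.od.prod (W.od.prod W.ev))
  od := W.od.prod (W.ev.prod (W.ev.prod W.od))
  isCompl := by
    refine isCompl_of ?_ ?_
    · rintro ⟨x, y, z, w⟩ h1 h2
      simp only [Submodule.mem_prod] at h1 h2
      simp only [Prod.mk_eq_zero]
      exact ⟨mem_zero W h1.1 h2.1, mem_zero W h2.2.1 h1.2.1, mem_zero W h2.2.2.1 h1.2.2.1,
        mem_zero W h1.2.2.2 h2.2.2.2⟩
    · rintro ⟨x, y, z, w⟩
      refine ⟨(eP W x, oP W y, oP W z, eP W w), ?_, (oP W x, eP W y, eP W z, oP W w), ?_, ?_⟩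
      · simp [Submodule.mem_prod, eP_mem, oP_mem]
      · simp [Submodule.mem_prod, eP_mem, oP_mem]
      · simp [eP_add_oP, add_comm (oP W _)]
  θ := ![
    { toFun := fun x => (x.2.1, 0, -x.2.2.2, 0)
      map_add' := by intros; simp [add_comm]
      map_smul' := by intros; simp },
    { toFun := fun x => (x.2.2.1, x.2.2.2, 0, 0)
      map_add' := by intros; simp
      map_smul' := by intros; simp }]
  θ_ev := by
    intro i; fin_cases i <;> rintro ⟨x, y, z, w⟩ h <;> simp_all [Submodule.mem_prod]
  θ_od := by
    intro i; fin_cases i <;> rintro ⟨x, y, z, w⟩ h <;> simp_all [Submodule.mem_prod]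

/-- elements of the coinduced module -/
def mk4 (W : GSupMod k (Fin 2)) (x y z w : W.carrier) : (coind W).carrier :=
  ((x, y, z, w) : W.carrier × W.carrier × W.carrier × W.carrier)

/-- first coordinate -/
def c1 (W : GSupMod k (Fin 2)) : (coind W).carrier →ₗ[k] W.carrier := LinearMap.fst k _ _

/-- second coordinate -/
def c2 (W : GSupMod k (Fin 2)) : (coind W).carrier →ₗ[k] W.carrier :=
  LinearMap.fst k _ _ ∘ₗ LinearMap.snd k _ _

/-- third coordinate -/
def c3 (W : GSupMod k (Fin 2)) : (coind W).carrier →ₗ[k] W.carrier :=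
  LinearMap.fst k _ _ ∘ₗ LinearMap.snd k _ _ ∘ₗ LinearMap.snd k _ _

/-- fourth coordinate -/
def c4 (W : GSupMod k (Fin 2)) : (coind W).carrier →ₗ[k] W.carrier :=
  LinearMap.snd k _ _ ∘ₗ LinearMap.snd k _ _ ∘ₗ LinearMap.snd k _ _

theorem c1_mk (W : GSupMod k (Fin 2)) (x y z w : W.carrier) : c1 W (mk4 W x y z w) = x := rfl

theorem c2_mk (W : GSupMod k (Fin 2)) (x y z w : W.carrier) : c2 W (mk4 W x y z w) = y := rfl

theorem c3_mk (W : GSupMod k (Fin 2)) (x y z w : W.carrier) : c3 W (mk4 W x y z w) = z := rfl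

theorem c4_mk (W : GSupMod k (Fin 2)) (x y z w : W.carrier) : c4 W (mk4 W x y z w) = w := rfl

theorem mk4_surj (W : GSupMod k (Fin 2)) (u : (coind W).carrier) :
    u = mk4 W (c1 W u) (c2 W u) (c3 W u) (c4 W u) := rfl

theorem mk4_add (W : GSupMod k (Fin 2)) (x y z w x' y' z' w' : W.carrier) :
    mk4 W x y z w + mk4 W x' y' z' w' = mk4 W (x + x') (y + y') (z + z') (w + w') := rfl

theorem mk4_sub (W : GSupMod k (Fin 2)) (x y z w x' y' z' w' : W.carrier) :
    mk4 W x y z w - mk4 W x' y' z' w' = mk4 W (x - x') (y - y') (z - z') (w - w') := rfl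

theorem mk4_zero (W : GSupMod k (Fin 2)) : mk4 W 0 0 0 0 = 0 := rfl

theorem coind_θ0 (W : GSupMod k (Fin 2)) (x y z w : W.carrier) :
    (coind W).θ 0 (mk4 W x y z w) = mk4 W y 0 (-w) 0 := rfl

theorem coind_θ1 (W : GSupMod k (Fin 2)) (x y z w : W.carrier) :
    (coind W).θ 1 (mk4 W x y z w) = mk4 W z w 0 0 := rfl

theorem coind_VCat (W : GSupMod k (Fin 2)) : VCat k 2 (coind W) := by
  intro i j
  fin_cases i <;> fin_cases j <;> refine LinearMap.ext fun u => ?_ <;> rw [mk4_surj W u] <;>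
    simp [coind_θ0, coind_θ1, mk4_add, mk4_zero]

section V2

variable [CharZero k]

theorem V_sq {r : ℕ} {M : GSupMod k (Fin r)} (hM : VCat k r M) (i : Fin r) (x : M.carrier) :
    M.θ i (M.θ i x) = 0 := by
  have := LinearMap.congr_fun (hM i i) x
  simp only [LinearMap.add_apply, LinearMap.comp_apply, LinearMap.zero_apply] at this
  rw [← two_smul k] at this
  simpa using this

theorem V_anti {M : GSupMod k (Fin 2)} (hM : VCat k 2 M) (x : M.carrier) :
    M.θ 1 (M.θ 0 x) = - M.θ 0 (M.θ 1 x) := by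
  have := LinearMap.congr_fun (hM 1 0) x
  simp only [LinearMap.add_apply, LinearMap.comp_apply, LinearMap.zero_apply] at this
  exact eq_neg_of_add_eq_zero_left this

/-- the map to the coinduced module attached to a linear map -/
def toCoind (M W : GSupMod k (Fin 2)) (l : M.carrier →ₗ[k] W.carrier) :
    M.carrier →ₗ[k] (coind W).carrier :=
  l.prod ((l ∘ₗ M.θ 0).prod ((l ∘ₗ M.θ 1).prod (l ∘ₗ M.θ 0 ∘ₗ M.θ 1)))

theorem toCoind_apply (M W : GSupMod k (Fin 2)) (l : M.carrier →ₗ[k] W.carrier) (x) :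
    toCoind M W l x = mk4 W (l x) (l (M.θ 0 x)) (l (M.θ 1 x)) (l (M.θ 0 (M.θ 1 x))) := rfl

theorem toCoind_hom {M W : GSupMod k (Fin 2)} (hM : VCat k 2 M)
    {l : M.carrier →ₗ[k] W.carrier} (hl : Gr M W l) : IsHom M (coind W) (toCoind M W l) := by
  refine ⟨fun i => ?_, fun m hm => ?_, fun m hm => ?_⟩
  · refine LinearMap.ext fun x => ?_
    fin_cases i
    · simp [toCoind_apply, coind_θ0, V_sq hM, V_anti hM]
    · simp [toCoind_apply, coind_θ1, V_sq hM, V_anti hM]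
  · exact ⟨hl.1 _ hm, hl.2 _ (M.θ_ev _ _ hm), hl.2 _ (M.θ_ev _ _ hm),
      hl.1 _ (M.θ_od _ _ (M.θ_ev _ _ hm))⟩
  · exact ⟨hl.2 _ hm, hl.1 _ (M.θ_od _ _ hm), hl.1 _ (M.θ_od _ _ hm),
      hl.2 _ (M.θ_ev _ _ (M.θ_od _ _ hm))⟩

theorem coind_inj (W : GSupMod k (Fin 2)) : IsInjective (VCat k 2) (coind W) := by
  refine ⟨coind_VCat W, fun M N j f hM hN hj hji hf => ?_⟩
  obtain ⟨r, hr, hrj⟩ := exists_retraction (IsHom.Gr hj) hji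
  let fst : (coind W).carrier →ₗ[k] W.carrier := LinearMap.fst k _ _
  have hfst : Gr (coind W) W fst := ⟨fun m hm => hm.1, fun m hm => hm.1⟩
  have hG : Gr N W (fst ∘ₗ f ∘ₗ r) :=
    ⟨fun m hm => hfst.1 _ (hf.2.1 _ (hr.1 _ hm)), fun m hm => hfst.2 _ (hf.2.2 _ (hr.2 _ hm))⟩
  refine ⟨toCoind N W (fst ∘ₗ f ∘ₗ r), toCoind_hom hN hG, LinearMap.ext fun x => ?_⟩
  simp only [LinearMap.comp_apply, toCoind_apply, ← IsHom.comm hj, hrj, IsHom.comm hf]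
  obtain ⟨y1, y2, y3, y4⟩ := f x
  rfl

theorem coind_proj (W : GSupMod k (Fin 2)) : IsProjective (VCat k 2) (coind W) := by
  refine ⟨coind_VCat W, fun M N π f hM hN hπ hs hf => ?_⟩
  obtain ⟨s, hs, hsp⟩ := exists_section (IsHom.Gr hπ) hs
  let inc : W.carrier →ₗ[k] (coind W).carrier :=
    LinearMap.inr k _ _ ∘ₗ LinearMap.inr k _ _ ∘ₗ LinearMap.inr k _ _
  have hinc : ∀ w, inc w = mk4 W 0 0 0 w := fun w => rfl
  obtain ⟨g, hgdef⟩ : ∃ g : W.carrier →ₗ[k] M.carrier, g = s ∘ₗ f ∘ₗ inc := ⟨_, rfl⟩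
  have hg : Gr W M g := by
    subst hgdef
    constructor
    · intro m hm
      exact hs.1 _ (hf.2.1 _ ⟨W.ev.zero_mem, W.od.zero_mem, W.od.zero_mem, hm⟩)
    · intro m hm
      exact hs.2 _ (hf.2.2 _ ⟨W.od.zero_mem, W.ev.zero_mem, W.ev.zero_mem, hm⟩)
  obtain ⟨h, hdef⟩ : ∃ h : (coind W).carrier →ₗ[k] M.carrier,
    h = g ∘ₗ c4 W + M.θ 1 ∘ₗ g ∘ₗ c2 W - M.θ 0 ∘ₗ g ∘ₗ c3 W + M.θ 0 ∘ₗ M.θ 1 ∘ₗ g ∘ₗ c1 W :=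
    ⟨_, rfl⟩
  have hh : ∀ x y z w : W.carrier, h (mk4 W x y z w) =
      g w + M.θ 1 (g y) - M.θ 0 (g z) + M.θ 0 (M.θ 1 (g x)) := fun x y z w => by
    rw [hdef]; rfl
  refine ⟨h, ⟨fun i => ?_, ?_, ?_⟩, ?_⟩
  · refine LinearMap.ext fun u => ?_
    rw [mk4_surj W u]
    fin_cases i
    · simp [hh, coind_θ0, V_sq hM, add_comm]
    · simp [hh, coind_θ1, V_sq hM, V_anti hM, add_comm]
  · intro u hu
    obtain ⟨h1, h2, h3, h4⟩ := hu
    rw [mk4_surj W u, hh]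
    exact add_mem (sub_mem (add_mem (hg.1 _ h4) (M.θ_od _ _ (hg.2 _ h2)))
      (M.θ_od _ _ (hg.2 _ h3))) (M.θ_od _ _ (M.θ_ev _ _ (hg.1 _ h1)))
  · intro u hu
    obtain ⟨h1, h2, h3, h4⟩ := hu
    rw [mk4_surj W u, hh]
    exact add_mem (sub_mem (add_mem (hg.2 _ h4) (M.θ_ev _ _ (hg.1 _ h2)))
      (M.θ_ev _ _ (hg.1 _ h3))) (M.θ_ev _ _ (M.θ_od _ _ (hg.2 _ h1)))
  · refine LinearMap.ext fun u => ?_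
    have hπg : ∀ w, π (g w) = f (inc w) := fun w => by rw [hgdef]; exact hsp _
    rw [mk4_surj W u, LinearMap.comp_apply, hh]
    simp only [map_add, map_sub, IsHom.comm hπ, hπg, ← IsHom.comm hf]
    rw [← map_add, ← map_sub, ← map_add]
    congr 1
    simp only [hinc, coind_θ0, coind_θ1, mk4_add, mk4_sub]
    simp

/-- a module without projective summands is killed by `θ 0 θ 1` -/
theorem noProj {M : GSupMod k (Fin 2)} (hM : VCat k 2 M) (hnp : NoProjSummands (VCat k 2) M)
    (x : M.carrier) : M.θ 0 (M.θ 1 x) = 0 := by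
  let R : Submodule k M.carrier := LinearMap.range (M.θ 0 ∘ₗ M.θ 1)
  have hR0 : ∀ i, ∀ y ∈ R, M.θ i y = 0 := by
    rintro i _ ⟨y, rfl⟩
    fin_cases i
    · simp [V_sq hM]
    · simp [V_sq hM, V_anti hM]
  have hi : ∀ i, ∀ y ∈ R, M.θ i y ∈ R := fun i y hy => by rw [hR0 i y hy]; exact R.zero_mem
  have he : ∀ y ∈ R, eP M y ∈ R := by
    rintro _ ⟨y, rfl⟩
    exact ⟨eP M y, by simp [eP_θ, oP_θ]⟩
  let W := subObj M R hi he
  obtain ⟨l, hl, hlr⟩ := exists_retraction (M := W) (IsHom.Gr (subObj_hom M R hi he))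
    R.subtype_injective
  have hlr' : ∀ y : M.carrier, l (M.θ 0 (M.θ 1 y)) = (⟨M.θ 0 (M.θ 1 y), y, rfl⟩ : R) :=
    fun y => hlr ⟨M.θ 0 (M.θ 1 y), y, rfl⟩
  have hF := toCoind_hom hM hl
  have hsurj : Function.Surjective (toCoind M W l) := by
    rw [← LinearMap.range_eq_top, eq_top_iff]
    have hr := range_hi hF
    obtain ⟨S, hS⟩ : ∃ S, S = LinearMap.range (toCoind M W l) := ⟨_, rfl⟩
    rw [← hS] at hr ⊢
    have k4 : ∀ w : W.carrier, ∃ x y z, mk4 W x y z w ∈ S := by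
      rintro ⟨_, y, rfl⟩
      refine ⟨l y, l (M.θ 0 y), l (M.θ 1 y), hS ▸ ⟨y, ?_⟩⟩
      rw [toCoind_apply, hlr']; rfl
    have k1 : ∀ w : W.carrier, mk4 W w 0 0 0 ∈ S := by
      intro w
      obtain ⟨x, y, z, h⟩ := k4 w
      simpa [coind_θ0, coind_θ1] using hr 0 _ (hr 1 _ h)
    have k2 : ∀ w : W.carrier, mk4 W 0 w 0 0 ∈ S := by
      intro w
      obtain ⟨x, y, z, h⟩ := k4 w
      simpa [coind_θ1, mk4_sub] using S.sub_mem (hr 1 _ h) (k1 z)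
    have k3 : ∀ w : W.carrier, mk4 W 0 0 w 0 ∈ S := by
      intro w
      obtain ⟨x, y, z, h⟩ := k4 (-w)
      simpa [coind_θ0, mk4_sub] using S.sub_mem (hr 0 _ h) (k1 y)
    intro u _
    obtain ⟨x, y, z, h⟩ := k4 (c4 W u)
    rw [mk4_surj W u]
    simpa [mk4_add] using S.add_mem h
      (S.add_mem (k1 (c1 W u - x)) (S.add_mem (k2 (c2 W u - y)) (k3 (c3 W u - z))))
  obtain ⟨h, hh, hFh⟩ := (coind_proj W).2 M (coind W) (toCoind M W l) LinearMap.id hM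
    (coind_VCat W) hF hsurj ⟨fun _ => rfl, fun _ h => h, fun _ h => h⟩
  have hFh' : ∀ u, toCoind M W l (h u) = u := fun u => LinearMap.congr_fun hFh u
  let B := subObj M _ (ker_hi hF) (ker_he hF)
  have hd : IsDsum (coind W) B M := by
    let φ : M.carrier ≃ₗ[k] (coind W).carrier × B.carrier :=
      { toFun := fun x => (toCoind M W l x, (⟨x - h (toCoind M W l x), by
            rw [LinearMap.mem_ker, map_sub, hFh', sub_self]⟩ :
            LinearMap.ker (toCoind M W l)))
        invFun := fun y => h y.1 + (show LinearMap.ker (toCoind M W l) from y.2).1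
        map_add' := fun x y => Prod.ext (map_add _ _ _) (Subtype.ext (by
          change _ = (x - h (toCoind M W l x)) + (y - h (toCoind M W l y))
          simp only [map_add]; abel))
        map_smul' := fun c x => Prod.ext (map_smul _ _ _) (Subtype.ext (by
          change _ = c • (x - h (toCoind M W l x))
          simp only [map_smul, smul_sub]))
        left_inv := fun x => by
          change h (toCoind M W l x) + (x - h (toCoind M W l x)) = x
          abel
        right_inv := by
          rintro ⟨u, y, hy⟩
          have hy' : toCoind M W l y = 0 := hy
          refine Prod.ext ?_ (Subtype.ext ?_)
          · change toCoind M W l (h u + y) = u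
            rw [map_add, hFh', hy', add_zero]
          · change (h u + y) - h (toCoind M W l (h u + y)) = y
            rw [map_add, hFh', hy', add_zero]; abel }
    have hφ1 : ∀ x, (φ x).1 = toCoind M W l x := fun x => rfl
    have hg : ∀ x, x = h (toCoind M W l x) + (x - h (toCoind M W l x)) := fun x => by abel
    refine ⟨φ, fun x => ⟨fun hx => ⟨hF.2.1 _ hx, ?_⟩, fun hx => ?_⟩,
      fun x => ⟨fun hx => ⟨hF.2.2 _ hx, ?_⟩, fun hx => ?_⟩, fun i x => ?_⟩
    · exact M.ev.sub_mem hx (hh.2.1 _ (hF.2.1 _ hx))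
    · rw [hg x]
      exact M.ev.add_mem (hh.2.1 _ hx.1) hx.2
    · exact M.od.sub_mem hx (hh.2.2 _ (hF.2.2 _ hx))
    · rw [hg x]
      exact M.od.add_mem (hh.2.2 _ hx.1) hx.2
    · refine Prod.ext (IsHom.comm hF i x) (Subtype.ext ?_)
      change M.θ i x - h (toCoind M W l (M.θ i x)) = M.θ i (x - h (toCoind M W l x))
      rw [map_sub, IsHom.comm hF, IsHom.comm hh]
  have h0 := hnp _ _ (coind_proj W) hd
    (mk4 W (l (M.θ 0 (M.θ 1 x))) 0 0 0)
  have h1 := congrArg (c1 W) h0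
  rw [c1_mk, map_zero, hlr'] at h1
  exact congrArg Subtype.val h1

/-- the socle -/
def soc (M : GSupMod k (Fin 2)) : Submodule k M.carrier :=
  LinearMap.ker (M.θ 0) ⊓ LinearMap.ker (M.θ 1)

theorem exists_hull {M : GSupMod k (Fin 2)} (hM : VCat k 2 M)
    (hz : ∀ x, M.θ 0 (M.θ 1 x) = 0) :
    ∃ (W : GSupMod k (Fin 2)) (F : M.carrier →ₗ[k] (coind W).carrier),
      Module.finrank k W.carrier = Module.finrank k (soc M) ∧
      IsInjHull (VCat k 2) M (coind W) F ∧ ∀ x, c4 W (F x) = 0 := by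
  have hR0 : ∀ i, ∀ y ∈ soc M, M.θ i y = 0 := by
    rintro i y ⟨h0, h1⟩
    fin_cases i
    · exact h0
    · exact h1
  have hi : ∀ i, ∀ y ∈ soc M, M.θ i y ∈ soc M :=
    fun i y hy => by rw [hR0 i y hy]; exact Submodule.zero_mem _
  have he : ∀ y ∈ soc M, eP M y ∈ soc M := by
    intro y hy
    constructor
    · rw [SetLike.mem_coe, LinearMap.mem_ker, ← oP_θ, hR0 _ _ hy, map_zero]
    · rw [SetLike.mem_coe, LinearMap.mem_ker, ← oP_θ, hR0 _ _ hy, map_zero]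
  let W := subObj M (soc M) hi he
  obtain ⟨l, hl, hlr⟩ := exists_retraction (M := W) (IsHom.Gr (subObj_hom M _ hi he))
    (soc M).subtype_injective
  have hl0 : ∀ y ∈ soc M, l y = 0 → y = 0 := fun y hy h => by
    have := hlr ⟨y, hy⟩
    exact congrArg Subtype.val (this.symm.trans h)
  have hF := toCoind_hom hM hl
  have hS0 : ∀ x, M.θ 0 x ∈ soc M := fun x => by
    constructor
    · exact V_sq hM 0 x
    · rw [SetLike.mem_coe, LinearMap.mem_ker, V_anti hM, hz, neg_zero]
  have hS1 : ∀ x, M.θ 1 x ∈ soc M := fun x => ⟨hz x, V_sq hM 1 x⟩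
  have hFW : ∀ w : W.carrier, toCoind M W l (show soc M from w).1 = mk4 W w 0 0 0 := by
    intro w
    have h1 : l (show soc M from w).1 = w := hlr w
    rw [toCoind_apply, hR0 0 _ (show soc M from w).2, hR0 1 _ (show soc M from w).2, h1]
    simp
  refine ⟨W, toCoind M W l, rfl, ⟨coind_inj W, hF, ?_, ?_⟩, ?_⟩
  · rw [injective_iff_map_eq_zero]
    intro x hx
    rw [toCoind_apply] at hx
    have h1 := congrArg (c1 W) hx
    have h2 := congrArg (c2 W) hx
    have h3 := congrArg (c3 W) hx
    rw [c1_mk, map_zero] at h1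
    rw [c2_mk, map_zero] at h2
    rw [c3_mk, map_zero] at h3
    exact hl0 x ⟨hl0 _ (hS0 x) h2, hl0 _ (hS1 x) h3⟩ h1
  · intro Q f hQ hf hinj
    have hw : ∀ w : W.carrier, f (mk4 W w 0 0 0) = 0 → w = 0 := by
      intro w hw
      rw [← hFW] at hw
      have : (show soc M from w).1 = 0 := by
        apply hinj
        rw [LinearMap.comp_apply, hw, map_zero]
      exact Subtype.ext this
    rw [injective_iff_map_eq_zero]
    intro u hu
    rw [mk4_surj W u] at hu ⊢
    have e4 : c4 W u = 0 := by
      apply hw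
      have := congrArg (Q.θ 0) (congrArg (Q.θ 1) hu)
      rw [← IsHom.comm hf, ← IsHom.comm hf, map_zero, map_zero, coind_θ1, coind_θ0] at this
      simpa using this
    rw [e4] at hu ⊢
    have e2 : c2 W u = 0 := by
      apply hw
      have := congrArg (Q.θ 0) hu
      rw [← IsHom.comm hf, map_zero, coind_θ0] at this
      simpa using this
    have e3 : c3 W u = 0 := by
      apply hw
      have := congrArg (Q.θ 1) hu
      rw [← IsHom.comm hf, map_zero, coind_θ1] at this
      simpa using this
    rw [e2, e3] at hu ⊢
    rw [hw _ hu, mk4_zero]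
  · intro x
    rw [toCoind_apply, c4_mk, hz, map_zero]

theorem rk_of {M W N : GSupMod k (Fin 2)} {F : M.carrier →ₗ[k] (coind W).carrier}
    (h4 : ∀ x, c4 W (F x) = 0) {p : (coind W).carrier →ₗ[k] N.carrier}
    (hp : IsHom (coind W) N p) (hs : Function.Surjective p)
    (hk : LinearMap.ker p = LinearMap.range F) :
    rk N = Module.finrank k W.carrier := by
  let q : (coind W).carrier →ₗ[k] N.carrier ⧸ radical N := (radical N).mkQ ∘ₗ p
  have hq : Function.Surjective q := (radical N).mkQ_surjective.comp hs
  have hc4 : Function.Surjective (c4 W) := fun w => ⟨mk4 W 0 0 0 w, rfl⟩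
  have hθ : ∀ i u, c4 W ((coind W).θ i u) = 0 := by
    intro i u
    rw [mk4_surj W u]
    fin_cases i
    · rfl
    · rfl
  have hrad : radical N ≤ Submodule.map p (LinearMap.ker (c4 W)) := by
    refine iSup_le fun i => ?_
    rintro _ ⟨y, rfl⟩
    obtain ⟨u, rfl⟩ := hs y
    exact ⟨(coind W).θ i u, hθ i u, IsHom.comm hp i u⟩
  have hmem : ∀ i y, N.θ i y ∈ radical N := fun i y =>
    (le_iSup (fun i => LinearMap.range (N.θ i)) i) ⟨y, rfl⟩
  have hker : LinearMap.ker q = LinearMap.ker (c4 W) := by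
    apply le_antisymm
    · intro u hu
      have hu' : p u ∈ radical N := by
        simpa [q] using hu
      obtain ⟨u', hu4, he⟩ := hrad hu'
      have : u - u' ∈ LinearMap.ker p := by
        rw [LinearMap.mem_ker, map_sub, he, sub_self]
      rw [hk] at this
      obtain ⟨x, hx⟩ := this
      have h := h4 x
      rw [hx, map_sub, LinearMap.mem_ker.1 hu4, sub_zero] at h
      exact h
    · intro u hu
      have hu' : p u ∈ radical N := by
        have e : u = (coind W).θ 1 (mk4 W 0 0 (c1 W u) (c2 W u)) +
            (coind W).θ 0 (mk4 W 0 0 0 (- c3 W u)) := by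
          conv_lhs => rw [mk4_surj W u, LinearMap.mem_ker.1 hu]
          rw [coind_θ1, coind_θ0, mk4_add]
          simp
        rw [e, map_add, IsHom.comm hp, IsHom.comm hp]
        exact add_mem (hmem _ _) (hmem _ _)
      simpa [q] using hu'
  have a1 := q.finrank_range_add_finrank_ker
  have a2 := (c4 W).finrank_range_add_finrank_ker
  rw [LinearMap.range_eq_top.2 hq, hker, finrank_top] at a1
  rw [LinearMap.range_eq_top.2 hc4, finrank_top] at a2
  unfold rk
  omega

theorem exists_cosyzygy {M : GSupMod k (Fin 2)} (hM : VCat k 2 M)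
    (hz : ∀ x, M.θ 0 (M.θ 1 x) = 0) :
    ∃ N, IsCosyzygy (VCat k 2) M N := by
  obtain ⟨W, F, -, hF, -⟩ := exists_hull hM hz
  refine ⟨quotObj (coind W) _ (range_hi hF.2.1) (range_he hF.2.1), ?_, coind W, F,
    (LinearMap.range F).mkQ, hF, quotObj_hom _ _ _ _, Submodule.mkQ_surjective _,
    Submodule.ker_mkQ _⟩
  intro i j
  refine LinearMap.ext fun y => ?_
  obtain ⟨u, rfl⟩ := Submodule.mkQ_surjective _ y
  have hq := quotObj_hom (coind W) _ (range_hi hF.2.1) (range_he hF.2.1)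
  have := congrArg (LinearMap.range F).mkQ (LinearMap.congr_fun (coind_VCat W i j) u)
  exact this

theorem rk_cosyzygy {M N : GSupMod k (Fin 2)} (hM : VCat k 2 M)
    (hz : ∀ x, M.θ 0 (M.θ 1 x) = 0) (hN : IsCosyzygy (VCat k 2) M N) :
    rk N = Module.finrank k (soc M) := by
  obtain ⟨W, F, hW, hF, h4⟩ := exists_hull hM hz
  obtain ⟨hNV, I, j, p, hj, hp, hps, hpk⟩ := hN
  obtain ⟨hcI, hFh, hFi, hFe⟩ := hF
  obtain ⟨hI, hjh, hji, hje⟩ := hj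
  obtain ⟨h, hh, hhF⟩ := hI.2 M (coind W) F j hM hcI.1 hFh hFi hjh
  obtain ⟨g, hg, hgj⟩ := hcI.2 M I j F hM hI.1 hjh hji hFh
  have hhi : Function.Injective h := hFe I h hI.1 hh (by rw [hhF]; exact hji)
  have hgi : Function.Injective g := hje _ g hcI.1 hg (by rw [hgj]; exact hFi)
  have hdim : Module.finrank k (coind W).carrier = Module.finrank k I.carrier :=
    le_antisymm (LinearMap.finrank_le_finrank_of_injective hhi)
      (LinearMap.finrank_le_finrank_of_injective hgi)
  have hhs : Function.Surjective h :=
    (LinearMap.injective_iff_surjective_of_finrank_eq_finrank hdim).1 hhi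
  rw [← hW]
  refine rk_of h4 (IsHom.comp hp hh) (hps.comp hhs) ?_
  rw [LinearMap.ker_comp, hpk, ← hhF, LinearMap.range_comp,
    Submodule.comap_map_eq_of_injective hhi]

end V2

/-! ### rank one -/

/-- the induced module over a rank one algebra -/
def ind1 (W : GSupMod k (Fin 1)) : GSupMod k (Fin 1) where
  carrier := W.carrier × W.carrier
  ev := W.ev.prod W.od
  od := W.od.prod W.ev
  isCompl := by
    refine isCompl_of ?_ ?_
    · rintro ⟨x, y⟩ h1 h2
      simp only [Submodule.mem_prod] at h1 h2
      simp only [Prod.mk_eq_zero]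
      exact ⟨mem_zero W h1.1 h2.1, mem_zero W h2.2 h1.2⟩
    · rintro ⟨x, y⟩
      refine ⟨(eP W x, oP W y), ?_, (oP W x, eP W y), ?_, ?_⟩
      · simp [Submodule.mem_prod, eP_mem, oP_mem]
      · simp [Submodule.mem_prod, eP_mem, oP_mem]
      · simp [eP_add_oP, add_comm (oP W _)]
  θ := fun _ => LinearMap.inr k _ _ ∘ₗ LinearMap.fst k _ _
  θ_ev := by
    rintro i ⟨x, y⟩ h
    simp_all [Submodule.mem_prod]
  θ_od := by
    rintro i ⟨x, y⟩ h
    simp_all [Submodule.mem_prod]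

/-- elements of the induced module -/
def mk2 (W : GSupMod k (Fin 1)) (x y : W.carrier) : (ind1 W).carrier :=
  ((x, y) : W.carrier × W.carrier)

/-- first coordinate -/
def d1 (W : GSupMod k (Fin 1)) : (ind1 W).carrier →ₗ[k] W.carrier := LinearMap.fst k _ _

/-- second coordinate -/
def d2 (W : GSupMod k (Fin 1)) : (ind1 W).carrier →ₗ[k] W.carrier := LinearMap.snd k _ _

theorem d1_mk (W : GSupMod k (Fin 1)) (x y : W.carrier) : d1 W (mk2 W x y) = x := rfl

theorem d2_mk (W : GSupMod k (Fin 1)) (x y : W.carrier) : d2 W (mk2 W x y) = y := rfl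

theorem mk2_surj (W : GSupMod k (Fin 1)) (u : (ind1 W).carrier) :
    u = mk2 W (d1 W u) (d2 W u) := rfl

theorem mk2_add (W : GSupMod k (Fin 1)) (x y x' y' : W.carrier) :
    mk2 W x y + mk2 W x' y' = mk2 W (x + x') (y + y') := rfl

theorem mk2_zero (W : GSupMod k (Fin 1)) : mk2 W 0 0 = 0 := rfl

theorem ind1_θ (W : GSupMod k (Fin 1)) (i : Fin 1) (x y : W.carrier) :
    (ind1 W).θ i (mk2 W x y) = mk2 W 0 x := rfl

theorem ind1_VCat (W : GSupMod k (Fin 1)) : VCat k 1 (ind1 W) := by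
  intro i j
  refine LinearMap.ext fun u => ?_
  rw [mk2_surj W u]
  simp [ind1_θ, mk2_zero]

section V1

variable [CharZero k]

/-- the canonical map from the induced module -/
def cov (W : GSupMod k (Fin 1)) : (ind1 W).carrier →ₗ[k] W.carrier := d1 W + W.θ 0 ∘ₗ d2 W

theorem cov_mk (W : GSupMod k (Fin 1)) (x y : W.carrier) :
    cov W (mk2 W x y) = x + W.θ 0 y := rfl

theorem cov_surj (W : GSupMod k (Fin 1)) : Function.Surjective (cov W) := fun x =>
  ⟨mk2 W x 0, by simp [cov_mk]⟩

theorem cov_hom {W : GSupMod k (Fin 1)} (hW : VCat k 1 W) : IsHom (ind1 W) W (cov W) := by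
  refine ⟨fun i => LinearMap.ext fun u => ?_, fun u hu => ?_, fun u hu => ?_⟩
  · obtain rfl : i = 0 := Subsingleton.elim _ _
    rw [mk2_surj W u]
    simp [ind1_θ, cov_mk, V_sq hW]
  · exact W.ev.add_mem hu.1 (W.θ_od _ _ hu.2)
  · exact W.od.add_mem hu.1 (W.θ_ev _ _ hu.2)

theorem ind1_proj (W : GSupMod k (Fin 1)) : IsProjective (VCat k 1) (ind1 W) := by
  refine ⟨ind1_VCat W, fun M N π f hM hN hπ hs hf => ?_⟩
  obtain ⟨s, hs, hsp⟩ := exists_section (IsHom.Gr hπ) hs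
  let inc : W.carrier →ₗ[k] (ind1 W).carrier := LinearMap.inl k _ _
  have hinc : ∀ w, inc w = mk2 W w 0 := fun w => rfl
  obtain ⟨g, hgdef⟩ : ∃ g : W.carrier →ₗ[k] M.carrier, g = s ∘ₗ f ∘ₗ inc := ⟨_, rfl⟩
  have hg : Gr W M g := by
    subst hgdef
    constructor
    · intro m hm
      exact hs.1 _ (hf.2.1 _ ⟨hm, W.od.zero_mem⟩)
    · intro m hm
      exact hs.2 _ (hf.2.2 _ ⟨hm, W.ev.zero_mem⟩)
  obtain ⟨h, hdef⟩ : ∃ h : (ind1 W).carrier →ₗ[k] M.carrier,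
    h = g ∘ₗ d1 W + M.θ 0 ∘ₗ g ∘ₗ d2 W := ⟨_, rfl⟩
  have hh : ∀ x y : W.carrier, h (mk2 W x y) = g x + M.θ 0 (g y) := fun x y => by
    rw [hdef]; rfl
  refine ⟨h, ⟨fun i => ?_, ?_, ?_⟩, ?_⟩
  · refine LinearMap.ext fun u => ?_
    obtain rfl : i = 0 := Subsingleton.elim _ _
    rw [mk2_surj W u]
    simp [hh, ind1_θ, V_sq hM]
  · intro u hu
    rw [mk2_surj W u, hh]
    exact add_mem (hg.1 _ hu.1) (M.θ_od _ _ (hg.2 _ hu.2))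
  · intro u hu
    rw [mk2_surj W u, hh]
    exact add_mem (hg.2 _ hu.1) (M.θ_ev _ _ (hg.1 _ hu.2))
  · refine LinearMap.ext fun u => ?_
    have hπg : ∀ w, π (g w) = f (inc w) := fun w => by rw [hgdef]; exact hsp _
    rw [mk2_surj W u, LinearMap.comp_apply, hh]
    simp only [map_add, IsHom.comm hπ, hπg, ← IsHom.comm hf]
    rw [← map_add]
    congr 1
    simp only [hinc, ind1_θ, mk2_add]
    simp

theorem proj_exact {P : GSupMod k (Fin 1)} (hP : IsProjective (VCat k 1) P) (x : P.carrier)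
    (hx : P.θ 0 x = 0) : ∃ y, P.θ 0 y = x := by
  obtain ⟨h, hh, hc⟩ := hP.2 (ind1 P) P (cov P) LinearMap.id (ind1_VCat P) hP.1
    (cov_hom hP.1) (cov_surj P) ⟨fun _ => rfl, fun _ h => h, fun _ h => h⟩
  have hc' : cov P (h x) = x := LinearMap.congr_fun hc x
  have h0 : (ind1 P).θ 0 (h x) = 0 := by rw [← IsHom.comm hh, hx, map_zero]
  rw [mk2_surj P (h x)] at h0 hc'
  rw [ind1_θ] at h0
  have h1 := congrArg (d2 P) h0
  rw [d2_mk, map_zero] at h1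
  rw [cov_mk, h1, zero_add] at hc'
  exact ⟨_, hc'⟩

theorem trivial_V {K : GSupMod k (Fin 1)} (h : ∀ i, K.θ i = 0) : VCat k 1 K := by
  intro i j
  simp [h]

theorem syz_dim {K T : GSupMod k (Fin 1)} {p : Bool} (hK : IsTrivial p K)
    (hT : IsSyzygy (VCat k 1) K T) : Module.finrank k T.carrier = 1 ∧ T.θ 0 = 0 := by
  obtain ⟨hK1, hK0, -⟩ := hK
  have hKV := trivial_V hK0
  obtain ⟨hTV, P, π, i, ⟨hP, hπ, hπs, hπe⟩, hi, hii, hr⟩ := hT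
  have hd : Module.finrank k T.carrier = 1 := by
    have a1 := π.finrank_range_add_finrank_ker
    rw [LinearMap.range_eq_top.2 hπs, finrank_top, hK1, ← hr,
      LinearMap.finrank_range_of_inj hii] at a1
    -- upper bound
    obtain ⟨h, hh, hc⟩ := (ind1_proj K).2 P K π (cov K) hP.1 hKV hπ hπs (cov_hom hKV)
    have hs : Function.Surjective h := hπe _ h (ind1_VCat K) hh (by rw [hc]; exact cov_surj K)
    have a2 := LinearMap.finrank_le_finrank_of_surjective hs
    have a3 : Module.finrank k (ind1 K).carrier = 2 := by
      change Module.finrank k (K.carrier × K.carrier) = 2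
      rw [Module.finrank_prod, hK1]
    -- lower bound
    have a4 : Module.finrank k T.carrier ≠ 0 := by
      intro h0
      have hP1 : Module.finrank k P.carrier = Module.finrank k K.carrier := by omega
      have hπi : Function.Injective π :=
        (LinearMap.injective_iff_surjective_of_finrank_eq_finrank hP1).2 hπs
      have hne : ∃ x : K.carrier, x ≠ 0 := by
        have : Nontrivial K.carrier := Module.nontrivial_of_finrank_pos (R := k) (by omega)
        exact exists_ne 0
      obtain ⟨x, hx⟩ := hne
      obtain ⟨y, rfl⟩ := hπs x
      have hy : P.θ 0 y = 0 := by
        apply hπi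
        rw [IsHom.comm hπ, hK0, map_zero]; rfl
      obtain ⟨z, rfl⟩ := proj_exact hP y hy
      apply hx
      rw [IsHom.comm hπ, hK0]; rfl
    omega
  refine ⟨hd, LinearMap.ext fun x => ?_⟩
  by_contra hne
  obtain ⟨c, hc⟩ := (finrank_eq_one_iff_of_nonzero' _ hne).1 hd x
  apply hne
  rw [← hc, map_smul]
  simp only [LinearMap.zero_apply]
  rw [V_sq hTV, smul_zero]

end V1

section Main

variable [CharZero k]

theorem exists_gen {M : GSupMod k (Fin 2)} (h2 : Cond2 M) {a : Fin 2 → k} (ha : a ≠ 0) :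
    ∃ v, IsOmegaComponentGen M a v := by
  obtain ⟨p, t, K, T, P, R, hK, hT, hP, ⟨ψ, hψe, hψo, hψθ⟩, ⟨φ, hφe, hφo, hφθ⟩⟩ := h2 a ha
  have hT1 : Module.finrank k T.carrier = 1 ∧ T.θ 0 = 0 := by
    rcases hT with ⟨-, e, he⟩ | ⟨-, hs⟩
    · refine ⟨by rw [← e.finrank_eq]; exact hK.1, LinearMap.ext fun x => ?_⟩
      obtain ⟨y, rfl⟩ := e.surjective x
      have := IsHom.comm he 0 y
      rw [hK.2.1] at this
      simpa using this.symm
    · exact syz_dim hK hs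
  obtain ⟨hT1, hT0⟩ := hT1
  obtain ⟨χ, hχ⟩ : ∃ χ : (T.carrier × P.carrier) ≃ₗ[k] M.carrier, χ = φ.symm.trans ψ := ⟨_, rfl⟩
  have hχe : ∀ x y, x ∈ T.ev → y ∈ P.ev → χ (x, y) ∈ M.ev := by
    intro x y hx hy
    rw [hχ, LinearEquiv.trans_apply, ← hψe, hφe]
    simpa using ⟨hx, hy⟩
  have hχo : ∀ x y, x ∈ T.od → y ∈ P.od → χ (x, y) ∈ M.od := by
    intro x y hx hy
    rw [hχ, LinearEquiv.trans_apply, ← hψo, hφo]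
    simpa using ⟨hx, hy⟩
  have hχθ : ∀ x y, actOf M a (χ (x, y)) = χ (0, P.θ 0 y) := by
    intro x y
    have h1 := hφθ 0 (φ.symm (x, y))
    rw [LinearEquiv.apply_symm_apply] at h1
    have h3 := hψθ 0 (φ.symm (x, y))
    have h4 : R.θ 0 (φ.symm (x, y)) = φ.symm (0, P.θ 0 y) := by
      apply φ.injective
      rw [h1, LinearEquiv.apply_symm_apply]
      simp [hT0]
    rw [h4] at h3
    simpa [hχ] using h3.symm
  have hnt : Nontrivial T.carrier := Module.nontrivial_of_finrank_pos (R := k) (by omega)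
  obtain ⟨t, ht⟩ := exists_ne (0 : T.carrier)
  have hspan : ∀ x : T.carrier, ∃ c : k, c • t = x := (finrank_eq_one_iff_of_nonzero' _ ht).1 hT1
  have hLmem : ∀ x : T.carrier, χ (x, 0) ∈ Submodule.span k {χ (t, 0)} := by
    intro x
    obtain ⟨c, rfl⟩ := hspan x
    rw [Submodule.mem_span_singleton]
    exact ⟨c, by rw [← map_smul]; simp⟩
  let PP : Submodule k M.carrier := LinearMap.range (χ.toLinearMap ∘ₗ LinearMap.inr k _ _)
  have hPmem : ∀ y : P.carrier, χ (0, y) ∈ PP := fun y => ⟨y, rfl⟩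
  refine ⟨χ (t, 0), ?_, Submodule.span k {χ (t, 0)}, PP, ?_, rfl, ?_, ?_, ?_, ?_⟩
  · intro h
    rw [LinearEquiv.map_eq_zero_iff, Prod.mk_eq_zero] at h
    exact ht h.1
  · refine isCompl_of ?_ ?_
    · rintro x hx ⟨y, rfl⟩
      obtain ⟨c, hc⟩ := Submodule.mem_span_singleton.1 hx
      rw [← map_smul] at hc
      have := χ.injective hc
      simp only [LinearMap.inr_apply, Prod.smul_mk, smul_zero, Prod.mk.injEq] at this
      simp [← this.2]
    · intro x
      obtain ⟨⟨y, z⟩, rfl⟩ := χ.surjective x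
      exact ⟨_, hLmem y, _, hPmem z, by rw [← map_add]; simp⟩
  · refine le_antisymm ?_ (sup_le inf_le_left inf_le_left)
    rw [Submodule.span_singleton_le_iff_mem, Submodule.mem_sup]
    exact ⟨χ (eP T t, 0), ⟨hLmem _, hχe _ _ (eP_mem T t) (zero_mem _)⟩, χ (oP T t, 0),
      ⟨hLmem _, hχo _ _ (oP_mem T t) (zero_mem _)⟩, by rw [← map_add]; simp [eP_add_oP]⟩
  · refine le_antisymm ?_ (sup_le inf_le_left inf_le_left)
    rintro _ ⟨y, rfl⟩
    rw [Submodule.mem_sup]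
    exact ⟨χ (0, eP P y), ⟨hPmem _, hχe _ _ (zero_mem _) (eP_mem P y)⟩, χ (0, oP P y),
      ⟨hPmem _, hχo _ _ (zero_mem _) (oP_mem P y)⟩, by rw [← map_add]; simp [eP_add_oP]⟩
  · rw [hχθ, map_zero]; exact map_zero χ
  · apply le_antisymm
    · rintro _ ⟨⟨y, rfl⟩, hy⟩
      have hy' : actOf M a (χ (0, y)) = 0 := hy
      rw [hχθ, LinearEquiv.map_eq_zero_iff, Prod.mk_eq_zero] at hy'
      obtain ⟨z, rfl⟩ := proj_exact hP y hy'.2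
      exact ⟨χ (0, z), hPmem z, hχθ _ _⟩
    · rintro _ ⟨_, ⟨y, rfl⟩, rfl⟩
      have e : actOf M a (χ (0, y)) = χ (0, P.θ 0 y) := hχθ _ _
      change actOf M a (χ (0, y)) ∈ _
      rw [e]
      refine ⟨hPmem _, ?_⟩
      change actOf M a (χ (0, P.θ 0 y)) = 0
      rw [hχθ, V_sq hP.1]
      exact map_zero χ

theorem gen_ker {M : GSupMod k (Fin 2)} {a : Fin 2 → k} {v : M.carrier}
    (h : IsOmegaComponentGen M a v) :
    (∀ x, actOf M a x = 0 → ∃ c : k, ∃ y, x = c • v + actOf M a y) ∧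
    Module.finrank k (LinearMap.ker (actOf M a)) =
      Module.finrank k (LinearMap.range (actOf M a)) + 1 := by
  obtain ⟨hv, L, P, hc, rfl, -, -, hav, hP⟩ := h
  have hdec : ∀ x, ∃ c : k, ∃ p ∈ P, x = c • v + p := by
    intro x
    obtain ⟨l, hl, p, hp, rfl⟩ := Submodule.mem_sup.1
      (show x ∈ Submodule.span k {v} ⊔ P by rw [hc.sup_eq_top]; trivial)
    obtain ⟨c, rfl⟩ := Submodule.mem_span_singleton.1 hl
    exact ⟨c, p, hp, rfl⟩
  have hmap : Submodule.map (actOf M a) P = LinearMap.range (actOf M a) := by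
    apply le_antisymm
    · rintro _ ⟨p, -, rfl⟩
      exact ⟨p, rfl⟩
    · rintro _ ⟨x, rfl⟩
      obtain ⟨c, p, hp, rfl⟩ := hdec x
      exact ⟨p, hp, by simp [hav]⟩
  have h1 : ∀ x, actOf M a x = 0 → ∃ c : k, ∃ y, x = c • v + actOf M a y := by
    intro x hx
    obtain ⟨c, p, hp, rfl⟩ := hdec x
    have hp0 : actOf M a p = 0 := by simpa [hav] using hx
    have : p ∈ LinearMap.range (actOf M a) := by
      rw [← hmap, ← hP]
      exact ⟨hp, hp0⟩
    obtain ⟨y, rfl⟩ := this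
    exact ⟨c, y, rfl⟩
  refine ⟨h1, ?_⟩
  have hRP : LinearMap.range (actOf M a) = P ⊓ LinearMap.ker (actOf M a) := by rw [hP, hmap]
  have hsup : LinearMap.ker (actOf M a) = LinearMap.range (actOf M a) ⊔ Submodule.span k {v} := by
    apply le_antisymm
    · intro x hx
      obtain ⟨c, y, rfl⟩ := h1 x hx
      rw [Submodule.mem_sup]
      exact ⟨_, ⟨y, rfl⟩, c • v, Submodule.mem_span_singleton.2 ⟨c, rfl⟩, add_comm _ _⟩
    · refine sup_le (hRP.le.trans inf_le_right) ?_
      rw [Submodule.span_singleton_le_iff_mem]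
      exact hav
  have hinf : LinearMap.range (actOf M a) ⊓ Submodule.span k {v} = ⊥ := by
    rw [eq_bot_iff]
    rintro x ⟨h3, h4⟩
    rw [hRP] at h3
    exact hc.disjoint.le_bot ⟨h4, h3.1⟩
  have := Submodule.finrank_sup_add_finrank_inf_eq (LinearMap.range (actOf M a))
    (Submodule.span k {v})
  rw [← hsup, hinf, finrank_bot, finrank_span_singleton hv] at this
  omega

theorem main_aux (M : GSupMod k (Fin 2)) (hM : VCat k 2 M)
    (hnp : NoProjSummands (VCat k 2) M) (h2 : Cond2 M)
    (a b : Fin 2 → k) (ha : a ≠ 0) (hb : b ∉ Submodule.span k {a}) :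
    Cond1 M ↔
      ∀ v : M.carrier, IsOmegaComponentGen M a v → actOf M b v ≠ 0 := by
  have hz := noProj hM hnp
  have hz' : ∀ i j x, M.θ i (M.θ j x) = 0 := by
    intro i j x
    fin_cases i <;> fin_cases j
    · exact V_sq hM 0 x
    · exact hz x
    · change M.θ 1 (M.θ 0 x) = 0
      rw [V_anti hM, hz, neg_zero]
    · exact V_sq hM 1 x
  have hact : ∀ (c : Fin 2 → k) x, actOf M c x = c 0 • M.θ 0 x + c 1 • M.θ 1 x := by
    intro c x
    simp [actOf, Fin.sum_univ_two]
  have hba : ∀ x, actOf M b (actOf M a x) = 0 := by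
    intro x
    simp [hact, hz']
  have hdet : a 0 * b 1 - a 1 * b 0 ≠ 0 := by
    intro hd
    apply hb
    rw [Submodule.mem_span_singleton]
    by_cases h0 : a 0 = 0
    · have h1 : a 1 ≠ 0 := by
        intro h1
        apply ha
        ext i
        fin_cases i
        · exact h0
        · exact h1
      refine ⟨b 1 / a 1, ?_⟩
      have hb0 : b 0 = 0 := by
        rw [h0, zero_mul, zero_sub, neg_eq_zero] at hd
        exact (mul_eq_zero.1 hd).resolve_left h1
      ext i
      fin_cases i
      · simp [h0, hb0]
      · simp [h1]
    · refine ⟨b 0 / a 0, ?_⟩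
      ext i
      fin_cases i
      · simp [h0]
      · simp only [Fin.mk_one, Fin.isValue, Pi.smul_apply, smul_eq_mul]
        field_simp
        linear_combination -hd
  have hsoc : soc M = LinearMap.ker (actOf M a) ⊓ LinearMap.ker (actOf M b) := by
    ext x
    simp only [soc, Submodule.mem_inf, LinearMap.mem_ker]
    constructor
    · rintro ⟨h0, h1⟩
      simp [hact, h0, h1]
    · rintro ⟨h0, h1⟩
      rw [hact] at h0 h1
      constructor
      · have : (a 0 * b 1 - a 1 * b 0) • M.θ 0 x = 0 := by
          have e : (a 0 * b 1 - a 1 * b 0) • M.θ 0 x = b 1 • (a 0 • M.θ 0 x + a 1 • M.θ 1 x)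
            - a 1 • (b 0 • M.θ 0 x + b 1 • M.θ 1 x) := by module
          rw [e, h0, h1]; simp
        exact (smul_eq_zero.1 this).resolve_left hdet
      · have : (a 0 * b 1 - a 1 * b 0) • M.θ 1 x = 0 := by
          have e : (a 0 * b 1 - a 1 * b 0) • M.θ 1 x = a 0 • (b 0 • M.θ 0 x + b 1 • M.θ 1 x)
            - b 0 • (a 0 • M.θ 0 x + a 1 • M.θ 1 x) := by module
          rw [e, h0, h1]; simp
        exact (smul_eq_zero.1 this).resolve_left hdet
  have hrn := (actOf M a).finrank_range_add_finrank_ker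
  have hrk : rk M + Module.finrank k (radical M) = Module.finrank k M.carrier :=
    Submodule.finrank_quotient_add_finrank (radical M)
  have hmem : ∀ i y, M.θ i y ∈ radical M := fun i y =>
    (le_iSup (fun i => LinearMap.range (M.θ i)) i) ⟨y, rfl⟩
  constructor
  · intro h1 v hv hbv
    obtain ⟨hk, hd⟩ := gen_ker hv
    obtain ⟨N, hN⟩ := exists_cosyzygy hM hz
    have hlt := h1 N hN
    rw [rk_cosyzygy hM hz hN] at hlt
    have e1 : LinearMap.ker (actOf M a) ≤ soc M := by
      rw [hsoc]
      refine le_inf le_rfl fun x hx => ?_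
      obtain ⟨c, y, rfl⟩ := hk x hx
      rw [LinearMap.mem_ker, map_add, map_smul, hbv, hba, smul_zero, zero_add]
    have e2 : LinearMap.range (actOf M a) ≤ radical M := by
      rintro _ ⟨x, rfl⟩
      rw [hact]
      exact add_mem (Submodule.smul_mem _ _ (hmem _ _)) (Submodule.smul_mem _ _ (hmem _ _))
    have f1 := Submodule.finrank_mono e1
    have f2 := Submodule.finrank_mono e2
    omega
  · intro h N hN
    rw [rk_cosyzygy hM hz hN]
    obtain ⟨v, hv⟩ := exists_gen h2 ha
    have hbv := h v hv
    obtain ⟨hk, hd⟩ := gen_ker hv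
    have e1 : soc M ≤ LinearMap.range (actOf M a) := by
      rw [hsoc]
      rintro x ⟨hx, hx'⟩
      obtain ⟨c, y, rfl⟩ := hk x hx
      rw [SetLike.mem_coe, LinearMap.mem_ker, map_add, map_smul, hba, add_zero] at hx'
      have hc := (smul_eq_zero.1 hx').resolve_right hbv
      rw [hc, zero_smul, zero_add]
      exact ⟨y, rfl⟩
    have e2 : radical M ≤ soc M := by
      refine iSup_le fun i => ?_
      rintro _ ⟨x, rfl⟩
      exact ⟨hz' 0 i x, hz' 1 i x⟩
    have f1 := Submodule.finrank_mono e1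
    have f2 := Submodule.finrank_mono e2
    omega

end Main

end SupCatAux

open SupCat SupCat.GSupMod in
/-- Let `M` be a `V(a₂)`-supermodule with no projective
submodules satisfying condition (2).  Let `a` be a nonzero element of
`(a₂)₁`, `b` a nonzero element of `(a₂)₁` not in the span of `a`, and let `v`
be a generator of the `Ω^t(k|⟨a⟩)` component in some decomposition of
`M|⟨a⟩`.  Then `M` satisfies condition (1) if and only if every such element
`v` satisfies `b.v ≠ 0`. -/
theorem cond1_iff_b_acts_nonzero_on_generators
    (k : Type) [Field k] [IsAlgClosed k] [CharZero k]
    (M : GSupMod k (Fin 2)) (hM : VCat k 2 M)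
    (hnp : NoProjSummands (VCat k 2) M)
    (h2 : Cond2 M)
    (a b : Fin 2 → k) (ha : a ≠ 0) (hb : b ∉ Submodule.span k {a}) :
    Cond1 M ↔
      ∀ v : M.carrier, IsOmegaComponentGen M a v → actOf M b v ≠ 0 := by
  exact SupCatAux.main_aux M hM hnp h2 a b ha hb
end
end

section
/- Let M be a V(a_2)-supermodule with no projective submodules satisfying condition (2). Then M satisfies condition (1) if and only if M satisfies condition (3). -/
/-!
A concrete model of the supermodule categories of the paper "On Endotrivial
Modules for Lie Superalgebras" attached to the detecting subalgebras
`e_r = q(1)^{×r}`, `f_n = sl(1|1)^{×n}`, to rank-one subalgebras `⟨z⟩` of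
`sl(1|1)`, and to the exterior superalgebras `V(a_r) = Λ((a_r)₁)`.

A `GSupMod k ι` is a finite-dimensional `ℤ₂`-graded `k`-vector space together
with a family of odd operators `θ i` (the actions of the distinguished odd
basis elements of the superalgebra: the `e_i` for `e_r`, the `x_i, y_i` for
`f_n`, the `a_i` for `V(a_r)`).  The even parts of all these superalgebras are
generated by the brackets of the odd generators, so the relations defining
each particular category, as well as complete reducibility over the even part,
are imposed by a predicate `𝒞 : GSupMod k ι → Prop`, defined separately for
each case.  All categorical notions (homomorphisms, isomorphisms, direct sums,
tensor products, duals, internal Hom, trivial modules, projectivity,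
projective covers and injective hulls, syzygies `Ωⁿ` for `n : ℤ`, endotrivial
modules, and the group `T` of stable classes of endotrivial modules) are
defined relative to such a predicate.
-/

noncomputable section

namespace SupCat

open GSupMod Submodule

variable {k : Type} [Field k]

/-! ### Graded linear maps -/

/-- `f` is a degree zero map of graded spaces. -/
def IsGr {ι ι' : Type} (M : GSupMod k ι) (N : GSupMod k ι')
    (f : M.carrier →ₗ[k] N.carrier) : Prop :=
  (∀ m ∈ M.ev, f m ∈ N.ev) ∧ (∀ m ∈ M.od, f m ∈ N.od)

theorem exists_parts {ι : Type} (M : GSupMod k ι) (m : M.carrier) :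
    ∃ e ∈ M.ev, ∃ o ∈ M.od, e + o = m := by
  have h : m ∈ M.ev ⊔ M.od := by rw [M.isCompl.sup_eq_top]; trivial
  exact Submodule.mem_sup.1 h

theorem eq_zero_of_parts {ι : Type} (M : GSupMod k ι) {m : M.carrier}
    (he : m ∈ M.ev) (ho : m ∈ M.od) : m = 0 :=
  Submodule.disjoint_def.1 M.isCompl.disjoint m he ho

theorem gradize {ι ι' : Type} (M : GSupMod k ι) (N : GSupMod k ι')
    (ψ : M.carrier →ₗ[k] N.carrier) :
    ∃ φ : M.carrier →ₗ[k] N.carrier, IsGr M N φ ∧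
      (∀ m ∈ M.ev, φ m - ψ m ∈ N.od) ∧ (∀ m ∈ M.od, φ m - ψ m ∈ N.ev) := by
  let p := M.ev.projection M.od M.isCompl
  let q := M.od.projection M.ev M.isCompl.symm
  let p' := N.ev.projection N.od N.isCompl
  let q' := N.od.projection N.ev N.isCompl.symm
  have hp : ∀ m ∈ M.ev, p m = m := fun m hm =>
    Submodule.projection_apply_left M.isCompl ⟨m, hm⟩
  have hp0 : ∀ m ∈ M.od, p m = 0 := fun m hm =>
    (Submodule.projection_apply_eq_zero_iff M.isCompl).2 hm
  have hq : ∀ m ∈ M.od, q m = m := fun m hm =>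
    Submodule.projection_apply_left M.isCompl.symm ⟨m, hm⟩
  have hq0 : ∀ m ∈ M.ev, q m = 0 := fun m hm =>
    (Submodule.projection_apply_eq_zero_iff M.isCompl.symm).2 hm
  have e1 : ∀ m ∈ M.ev, (p' ∘ₗ ψ ∘ₗ p + q' ∘ₗ ψ ∘ₗ q) m = p' (ψ m) := by
    intro m hm; simp [hp m hm, hq0 m hm]
  have e2 : ∀ m ∈ M.od, (p' ∘ₗ ψ ∘ₗ p + q' ∘ₗ ψ ∘ₗ q) m = q' (ψ m) := by
    intro m hm; simp [hp0 m hm, hq m hm]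
  refine ⟨p' ∘ₗ ψ ∘ₗ p + q' ∘ₗ ψ ∘ₗ q, ⟨?_, ?_⟩, ?_, ?_⟩
  · intro m hm; rw [e1 m hm]; exact Submodule.projection_apply_mem _ _
  · intro m hm; rw [e2 m hm]; exact Submodule.projection_apply_mem _ _
  · intro m hm; rw [e1 m hm, ← neg_sub]
    exact N.od.neg_mem (Submodule.sub_projection_mem N.isCompl _)
  · intro m hm; rw [e2 m hm, ← neg_sub]
    exact N.ev.neg_mem (Submodule.sub_projection_mem N.isCompl.symm _)

theorem gr_extend {ι ι' ι'' : Type} (X : GSupMod k ι) (Y : GSupMod k ι') (V : GSupMod k ι'')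
    (j : X.carrier →ₗ[k] Y.carrier) (hj : IsGr X Y j) (hinj : Function.Injective j)
    (f : X.carrier →ₗ[k] V.carrier) (hf : IsGr X V f) :
    ∃ φ : Y.carrier →ₗ[k] V.carrier, IsGr Y V φ ∧ φ ∘ₗ j = f := by
  obtain ⟨g, hg⟩ := LinearMap.exists_leftInverse_of_injective j (LinearMap.ker_eq_bot.2 hinj)
  have hg' : ∀ x, g (j x) = x := fun x => LinearMap.congr_fun hg x
  obtain ⟨φ, h1, h2, h3⟩ := gradize Y V (f ∘ₗ g)
  refine ⟨φ, h1, ?_⟩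
  ext x
  obtain ⟨e, he, o, ho, rfl⟩ := exists_parts X x
  have a1 := h2 _ (hj.1 e he)
  have a2 := h3 _ (hj.2 o ho)
  simp only [LinearMap.comp_apply, hg'] at a1 a2
  have b1 := eq_zero_of_parts V (V.ev.sub_mem (h1.1 _ (hj.1 e he)) (hf.1 e he)) a1
  have b2 := eq_zero_of_parts V a2 (V.od.sub_mem (h1.2 _ (hj.2 o ho)) (hf.2 o ho))
  simp only [LinearMap.comp_apply, map_add]
  rw [sub_eq_zero.1 b1, sub_eq_zero.1 b2]

theorem gr_lift {ι ι' ι'' : Type} (X : GSupMod k ι) (Y : GSupMod k ι') (V : GSupMod k ι'')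
    (π : X.carrier →ₗ[k] Y.carrier) (hπ : IsGr X Y π) (hsurj : Function.Surjective π)
    (f : V.carrier →ₗ[k] Y.carrier) (hf : IsGr V Y f) :
    ∃ φ : V.carrier →ₗ[k] X.carrier, IsGr V X φ ∧ π ∘ₗ φ = f := by
  obtain ⟨g, hg⟩ := LinearMap.exists_rightInverse_of_surjective π (LinearMap.range_eq_top.2 hsurj)
  have hg' : ∀ x, π (g x) = x := fun x => LinearMap.congr_fun hg x
  obtain ⟨φ, h1, h2, h3⟩ := gradize V X (g ∘ₗ f)
  refine ⟨φ, h1, ?_⟩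
  ext x
  obtain ⟨e, he, o, ho, rfl⟩ := exists_parts V x
  have a1 := hπ.2 _ (h2 e he)
  have a2 := hπ.1 _ (h3 o ho)
  simp only [LinearMap.comp_apply, map_sub, hg'] at a1 a2
  have b1 := eq_zero_of_parts Y (Y.ev.sub_mem (hπ.1 _ (h1.1 _ he)) (hf.1 e he)) a1
  have b2 := eq_zero_of_parts Y a2 (Y.od.sub_mem (hπ.2 _ (h1.2 _ ho)) (hf.2 o ho))
  simp only [LinearMap.comp_apply, map_add]
  rw [sub_eq_zero.1 b1, sub_eq_zero.1 b2]

/-! ### Sub and quotient objects -/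

/-- `W` is a graded subspace. -/
def IsGrSub {ι : Type} (M : GSupMod k ι) (W : Submodule k M.carrier) : Prop :=
  ∀ e ∈ M.ev, ∀ o ∈ M.od, e + o ∈ W → e ∈ W

theorem IsGrSub.od {ι : Type} {M : GSupMod k ι} {W : Submodule k M.carrier}
    (h : IsGrSub M W) {e o : M.carrier} (he : e ∈ M.ev) (ho : o ∈ M.od) (hw : e + o ∈ W) :
    o ∈ W := by
  have := W.sub_mem hw (h e he o ho hw)
  simpa using this

/-- The subobject on a graded invariant subspace. -/
def subObj {ι : Type} (M : GSupMod k ι) (W : Submodule k M.carrier)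
    (hg : IsGrSub M W) (hi : ∀ i, ∀ m ∈ W, M.θ i m ∈ W) : GSupMod k ι where
  carrier := W
  ev := M.ev.comap W.subtype
  od := M.od.comap W.subtype
  isCompl := by
    constructor
    · rw [Submodule.disjoint_def]
      intro x h1 h2
      exact Subtype.ext (eq_zero_of_parts M h1 h2)
    · rw [codisjoint_iff, eq_top_iff]
      rintro ⟨x, hx⟩ -
      obtain ⟨e, he, o, ho, rfl⟩ := exists_parts M x
      exact Submodule.mem_sup.2 ⟨⟨e, hg e he o ho hx⟩, he, ⟨o, hg.od he ho hx⟩, ho, rfl⟩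
  θ i := (M.θ i).restrict (hi i)
  θ_ev i m hm := M.θ_ev i _ hm
  θ_od i m hm := M.θ_od i _ hm

/-- The quotient object by a graded invariant subspace. -/
def quotObj {ι : Type} (M : GSupMod k ι) (W : Submodule k M.carrier)
    (hg : IsGrSub M W) (hi : ∀ i, ∀ m ∈ W, M.θ i m ∈ W) : GSupMod k ι where
  carrier := M.carrier ⧸ W
  ev := M.ev.map W.mkQ
  od := M.od.map W.mkQ
  isCompl := by
    constructor
    · rw [Submodule.disjoint_def]
      rintro x ⟨e, he, rfl⟩ ⟨o, ho, h⟩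
      have h' : e + -o ∈ W := by
        rw [← sub_eq_add_neg]
        exact (Submodule.Quotient.eq W).1 h.symm
      exact (Submodule.Quotient.mk_eq_zero W).2 (hg e he _ (M.od.neg_mem ho) h')
    · rw [codisjoint_iff, ← Submodule.map_sup, M.isCompl.sup_eq_top, Submodule.map_top,
        Submodule.range_mkQ]
  θ i := W.mapQ W (M.θ i) (hi i)
  θ_ev i := by
    rintro _ ⟨e, he, rfl⟩
    exact ⟨_, M.θ_ev i e he, rfl⟩
  θ_od i := by
    rintro _ ⟨e, he, rfl⟩
    exact ⟨_, M.θ_od i e he, rfl⟩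

/-! ### Free objects of rank two -/

/-- The (co)free `V(a₂)`-supermodule on a graded space. -/
def freeObj (V : GSupMod k (Fin 2)) : GSupMod k (Fin 2) where
  carrier := V.carrier × V.carrier × V.carrier × V.carrier
  ev := V.ev.prod (V.od.prod (V.od.prod V.ev))
  od := V.od.prod (V.ev.prod (V.ev.prod V.od))
  isCompl := by
    constructor
    · rw [Submodule.disjoint_def]
      rintro ⟨x, y, w, z⟩ ⟨h1, h2, h3, h4⟩ ⟨g1, g2, g3, g4⟩
      have := eq_zero_of_parts V h1 g1
      have := eq_zero_of_parts V g2 h2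
      have := eq_zero_of_parts V g3 h3
      have := eq_zero_of_parts V h4 g4
      simp_all
    · rw [codisjoint_iff, eq_top_iff]
      rintro ⟨x, y, w, z⟩ -
      obtain ⟨xe, hxe, xo, hxo, rfl⟩ := exists_parts V x
      obtain ⟨ye, hye, yo, hyo, rfl⟩ := exists_parts V y
      obtain ⟨we, hwe, wo, hwo, rfl⟩ := exists_parts V w
      obtain ⟨ze, hze, zo, hzo, rfl⟩ := exists_parts V z
      refine Submodule.mem_sup.2 ⟨(xe, yo, wo, ze), ⟨hxe, hyo, hwo, hze⟩,
        (xo, ye, we, zo), ⟨hxo, hye, hwe, hzo⟩, ?_⟩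
      simp [add_comm]
  θ := ![
    LinearMap.prod 0 (LinearMap.prod (LinearMap.fst k _ _) (LinearMap.prod 0
      (LinearMap.fst k _ _ ∘ₗ LinearMap.snd k _ _ ∘ₗ LinearMap.snd k _ _))),
    LinearMap.prod 0 (LinearMap.prod 0 (LinearMap.prod (LinearMap.fst k _ _)
      (-(LinearMap.fst k _ _ ∘ₗ LinearMap.snd k _ _))))]
  θ_ev i := by
    rintro ⟨x, y, w, z⟩ ⟨h1, h2, h3, h4⟩
    fin_cases i
    · exact ⟨V.od.zero_mem, h1, V.ev.zero_mem, h3⟩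
    · exact ⟨V.od.zero_mem, V.ev.zero_mem, h1, V.od.neg_mem h2⟩
  θ_od i := by
    rintro ⟨x, y, w, z⟩ ⟨h1, h2, h3, h4⟩
    fin_cases i
    · exact ⟨V.ev.zero_mem, h1, V.od.zero_mem, h3⟩
    · exact ⟨V.ev.zero_mem, V.od.zero_mem, h1, V.ev.neg_mem h2⟩

/-- The element of the free object with given coordinates. -/
def fmk (V : GSupMod k (Fin 2)) (x y w z : V.carrier) : (freeObj V).carrier :=
  ((x, y, w, z) : V.carrier × V.carrier × V.carrier × V.carrier)

theorem free_cases (V : GSupMod k (Fin 2)) (u : (freeObj V).carrier) :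
    ∃ x y w z, u = fmk V x y w z := ⟨u.1, u.2.1, u.2.2.1, u.2.2.2, rfl⟩

theorem fmk_inj (V : GSupMod k (Fin 2)) {x y w z x' y' w' z' : V.carrier} :
    fmk V x y w z = fmk V x' y' w' z' ↔ x = x' ∧ y = y' ∧ w = w' ∧ z = z' := by
  show ((x, y, w, z) : V.carrier × V.carrier × V.carrier × V.carrier) = (x', y', w', z') ↔ _
  simp

theorem fmk_zero (V : GSupMod k (Fin 2)) : fmk V 0 0 0 0 = 0 := rfl

theorem fmk_add (V : GSupMod k (Fin 2)) (x y w z x' y' w' z' : V.carrier) :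
    fmk V x y w z + fmk V x' y' w' z' = fmk V (x + x') (y + y') (w + w') (z + z') := rfl

theorem fmk_neg (V : GSupMod k (Fin 2)) (x y w z : V.carrier) :
    - fmk V x y w z = fmk V (-x) (-y) (-w) (-z) := rfl

/-- The last coordinate. -/
def fZ (V : GSupMod k (Fin 2)) : (freeObj V).carrier →ₗ[k] V.carrier :=
  LinearMap.snd k _ _ ∘ₗ LinearMap.snd k _ _ ∘ₗ LinearMap.snd k _ _

/-- The first coordinate. -/
def fX (V : GSupMod k (Fin 2)) : (freeObj V).carrier →ₗ[k] V.carrier :=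
  LinearMap.fst k _ _

/-- The inclusion of the generators. -/
def fI (V : GSupMod k (Fin 2)) : V.carrier →ₗ[k] (freeObj V).carrier :=
  LinearMap.inl k _ _

theorem fZ_mk (V : GSupMod k (Fin 2)) (x y w z : V.carrier) : fZ V (fmk V x y w z) = z := rfl
theorem fX_mk (V : GSupMod k (Fin 2)) (x y w z : V.carrier) : fX V (fmk V x y w z) = x := rfl
theorem fI_apply (V : GSupMod k (Fin 2)) (x : V.carrier) : fI V x = fmk V x 0 0 0 := rfl

theorem free_θ0 (V : GSupMod k (Fin 2)) (x y w z : V.carrier) :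
    (freeObj V).θ 0 (fmk V x y w z) = fmk V 0 x 0 w := rfl

theorem free_θ1 (V : GSupMod k (Fin 2)) (x y w z : V.carrier) :
    (freeObj V).θ 1 (fmk V x y w z) = fmk V 0 0 x (-y) := rfl

theorem vcat_iff [CharZero k] (M : GSupMod k (Fin 2)) : VCat k 2 M ↔
    (∀ m, M.θ 0 (M.θ 0 m) = 0) ∧ (∀ m, M.θ 1 (M.θ 1 m) = 0) ∧
    (∀ m, M.θ 1 (M.θ 0 m) = - M.θ 0 (M.θ 1 m)) := by
  have half : ∀ x : M.carrier, x + x = 0 → x = 0 := by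
    intro x hx
    rw [← two_smul k, smul_eq_zero] at hx
    exact hx.resolve_left two_ne_zero
  constructor
  · intro h
    refine ⟨fun m => half _ (LinearMap.congr_fun (h 0 0) m),
      fun m => half _ (LinearMap.congr_fun (h 1 1) m), fun m => ?_⟩
    exact eq_neg_of_add_eq_zero_left (LinearMap.congr_fun (h 1 0) m)
  · rintro ⟨h0, h1, h2⟩ i j
    ext m
    fin_cases i <;> fin_cases j <;> simp [h0, h1, h2]

theorem free_vcat [CharZero k] (V : GSupMod k (Fin 2)) : VCat k 2 (freeObj V) := by
  rw [vcat_iff]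
  refine ⟨?_, ?_, ?_⟩ <;> intro u <;> obtain ⟨x, y, w, z, rfl⟩ := free_cases V u <;>
    simp [free_θ0, free_θ1, fmk_neg, fmk_zero]

/-- The homomorphism out of a free object induced by a graded map. -/
def fromFree (V N : GSupMod k (Fin 2)) (g : V.carrier →ₗ[k] N.carrier) :
    (freeObj V).carrier →ₗ[k] N.carrier :=
  LinearMap.coprod g (LinearMap.coprod (N.θ 0 ∘ₗ g) (LinearMap.coprod (N.θ 1 ∘ₗ g)
    (N.θ 0 ∘ₗ N.θ 1 ∘ₗ g)))

theorem fromFree_apply (V N : GSupMod k (Fin 2)) (g : V.carrier →ₗ[k] N.carrier)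
    (x y w z : V.carrier) : fromFree V N g (fmk V x y w z) =
      g x + (N.θ 0 (g y) + (N.θ 1 (g w) + N.θ 0 (N.θ 1 (g z)))) := rfl

theorem fromFree_hom [CharZero k] (V N : GSupMod k (Fin 2)) (hN : VCat k 2 N)
    (g : V.carrier →ₗ[k] N.carrier) (hg : IsGr V N g) :
    IsHom (freeObj V) N (fromFree V N g) := by
  obtain ⟨h0, h1, h2⟩ := (vcat_iff N).1 hN
  refine ⟨?_, ?_, ?_⟩
  · intro i
    refine LinearMap.ext fun u => ?_
    obtain ⟨x, y, w, z, rfl⟩ := free_cases V u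
    fin_cases i
    · show fromFree V N g ((freeObj V).θ 0 (fmk V x y w z)) = N.θ 0 (fromFree V N g (fmk V x y w z))
      simp [free_θ0, fromFree_apply, h0]
    · show fromFree V N g ((freeObj V).θ 1 (fmk V x y w z)) = N.θ 1 (fromFree V N g (fmk V x y w z))
      simp [free_θ1, fromFree_apply, h1, h2]
  · rintro ⟨x, y, w, z⟩ ⟨hx, hy, hw, hz⟩
    refine (fromFree_apply V N g x y w z).symm ▸ ?_
    exact N.ev.add_mem (hg.1 _ hx) (N.ev.add_mem (N.θ_od _ _ (hg.2 _ hy))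
      (N.ev.add_mem (N.θ_od _ _ (hg.2 _ hw)) (N.θ_od _ _ (N.θ_ev _ _ (hg.1 _ hz)))))
  · rintro ⟨x, y, w, z⟩ ⟨hx, hy, hw, hz⟩
    refine (fromFree_apply V N g x y w z).symm ▸ ?_
    exact N.od.add_mem (hg.2 _ hx) (N.od.add_mem (N.θ_ev _ _ (hg.1 _ hy))
      (N.od.add_mem (N.θ_ev _ _ (hg.1 _ hw)) (N.θ_ev _ _ (N.θ_od _ _ (hg.2 _ hz)))))

/-- The homomorphism into a cofree object induced by a graded map. -/
def toFree (V N : GSupMod k (Fin 2)) (φ : N.carrier →ₗ[k] V.carrier) :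
    N.carrier →ₗ[k] (freeObj V).carrier :=
  LinearMap.prod (φ ∘ₗ N.θ 0 ∘ₗ N.θ 1) (LinearMap.prod (-(φ ∘ₗ N.θ 1))
    (LinearMap.prod (φ ∘ₗ N.θ 0) φ))

theorem toFree_apply (V N : GSupMod k (Fin 2)) (φ : N.carrier →ₗ[k] V.carrier)
    (n : N.carrier) : toFree V N φ n =
      fmk V (φ (N.θ 0 (N.θ 1 n))) (-φ (N.θ 1 n)) (φ (N.θ 0 n)) (φ n) := rfl

theorem toFree_hom [CharZero k] (V N : GSupMod k (Fin 2)) (hN : VCat k 2 N)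
    (φ : N.carrier →ₗ[k] V.carrier) (hφ : IsGr N V φ) :
    IsHom N (freeObj V) (toFree V N φ) := by
  obtain ⟨h0, h1, h2⟩ := (vcat_iff N).1 hN
  refine ⟨?_, ?_, ?_⟩
  · intro i
    refine LinearMap.ext fun n => ?_
    fin_cases i
    · show toFree V N φ (N.θ 0 n) = (freeObj V).θ 0 (toFree V N φ n)
      simp [toFree_apply, free_θ0, h0, h2]
    · show toFree V N φ (N.θ 1 n) = (freeObj V).θ 1 (toFree V N φ n)
      simp [toFree_apply, free_θ1, h1]
  · intro n hn
    exact ⟨hφ.1 _ (N.θ_od _ _ (N.θ_ev _ _ hn)), V.od.neg_mem (hφ.2 _ (N.θ_ev _ _ hn)),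
      hφ.2 _ (N.θ_ev _ _ hn), hφ.1 _ hn⟩
  · intro n hn
    exact ⟨hφ.2 _ (N.θ_ev _ _ (N.θ_od _ _ hn)), V.ev.neg_mem (hφ.1 _ (N.θ_od _ _ hn)),
      hφ.1 _ (N.θ_od _ _ hn), hφ.2 _ hn⟩

theorem IsHom.gr {ι : Type} {M N : GSupMod k ι} {f : M.carrier →ₗ[k] N.carrier}
    (h : IsHom M N f) : IsGr M N f := h.2

theorem IsHom.app {ι : Type} {M N : GSupMod k ι} {f : M.carrier →ₗ[k] N.carrier}
    (h : IsHom M N f) (i : ι) (m : M.carrier) : f (M.θ i m) = N.θ i (f m) :=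
  LinearMap.congr_fun (h.1 i) m

theorem free_injective [CharZero k] (V : GSupMod k (Fin 2)) :
    IsInjective (VCat k 2) (freeObj V) := by
  refine ⟨free_vcat V, ?_⟩
  intro X Y j f hX hY hj hinj hf
  obtain ⟨φ, hφ, he⟩ := gr_extend X Y V j (IsHom.gr hj) hinj (fZ V ∘ₗ f)
    ⟨fun m hm => (hf.2.1 m hm).2.2.2, fun m hm => (hf.2.2 m hm).2.2.2⟩
  have he' : ∀ x, φ (j x) = fZ V (f x) := fun x => LinearMap.congr_fun he x
  refine ⟨toFree V Y φ, toFree_hom V Y hY φ hφ, ?_⟩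
  refine LinearMap.ext fun x => ?_
  show toFree V Y φ (j x) = f x
  rw [toFree_apply, ← IsHom.app hj, ← IsHom.app hj, ← IsHom.app hj, he', he', he', he',
    IsHom.app hf, IsHom.app hf, IsHom.app hf]
  obtain ⟨x, y, w, z, hu⟩ := free_cases V (f x)
  simp [hu, free_θ0, free_θ1, fZ_mk]

theorem free_projective [CharZero k] (V : GSupMod k (Fin 2)) :
    IsProjective (VCat k 2) (freeObj V) := by
  refine ⟨free_vcat V, ?_⟩
  intro X Y π f hX hY hπ hsurj hf
  obtain ⟨g, hg, he⟩ := gr_lift X Y V π (IsHom.gr hπ) hsurj (f ∘ₗ fI V)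
    ⟨fun m hm => hf.2.1 _ ⟨hm, V.od.zero_mem, V.od.zero_mem, V.ev.zero_mem⟩,
     fun m hm => hf.2.2 _ ⟨hm, V.ev.zero_mem, V.ev.zero_mem, V.od.zero_mem⟩⟩
  have he' : ∀ x, π (g x) = f (fmk V x 0 0 0) := fun x => LinearMap.congr_fun he x
  refine ⟨fromFree V X g, fromFree_hom V X hX g hg, ?_⟩
  refine LinearMap.ext fun u => ?_
  obtain ⟨x, y, w, z, rfl⟩ := free_cases V u
  show π (fromFree V X g (fmk V x y w z)) = f (fmk V x y w z)
  rw [fromFree_apply, map_add, map_add, map_add, IsHom.app hπ, IsHom.app hπ, IsHom.app hπ,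
    IsHom.app hπ, he', he', he', he', ← IsHom.app hf, ← IsHom.app hf, ← IsHom.app hf,
    ← IsHom.app hf, ← map_add, ← map_add, ← map_add]
  simp [free_θ0, free_θ1, fmk_add]

/-! ### No projective summands -/

theorem split_dsum {ι : Type} (A M : GSupMod k ι) (f : A.carrier →ₗ[k] M.carrier)
    (ρ : M.carrier →ₗ[k] A.carrier) (hf : IsHom A M f) (hρ : IsHom M A ρ)
    (h : ρ ∘ₗ f = LinearMap.id) : ∃ B : GSupMod k ι, IsDsum A B M := by
  have h' : ∀ a, ρ (f a) = a := fun a => LinearMap.congr_fun h a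
  have hg : IsGrSub M (LinearMap.ker ρ) := by
    intro e he o ho hw
    rw [LinearMap.mem_ker, map_add] at hw
    refine eq_zero_of_parts A (hρ.2.1 e he) ?_
    rw [eq_neg_of_add_eq_zero_left hw]
    exact A.od.neg_mem (hρ.2.2 o ho)
  have hi : ∀ i, ∀ m ∈ LinearMap.ker ρ, M.θ i m ∈ LinearMap.ker ρ := by
    intro i m hm
    rw [LinearMap.mem_ker] at hm ⊢
    rw [IsHom.app hρ, hm, map_zero]
  have hk : ∀ m, m - f (ρ m) ∈ LinearMap.ker ρ := by
    intro m; simp [h']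
  let φ : M.carrier ≃ₗ[k] A.carrier × (LinearMap.ker ρ) :=
    LinearEquiv.ofLinearMap
      (LinearMap.prod ρ ((LinearMap.id - f ∘ₗ ρ).codRestrict (LinearMap.ker ρ) hk))
      (LinearMap.coprod f (LinearMap.ker ρ).subtype)
      (by
        ext a <;> simp [h'])
      (by ext m; simp)
  refine ⟨subObj M (LinearMap.ker ρ) hg hi, φ, ?_, ?_, ?_⟩
  · intro s
    constructor
    · intro hs
      exact ⟨hρ.2.1 s hs, M.ev.sub_mem hs (hf.2.1 _ (hρ.2.1 s hs))⟩
    · rintro ⟨h1, h2⟩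
      have h2' : s - f (ρ s) ∈ M.ev := h2
      have := M.ev.add_mem h2' (hf.2.1 _ h1)
      change s - f (ρ s) + f (ρ s) ∈ M.ev at this
      simpa using this
  · intro s
    constructor
    · intro hs
      exact ⟨hρ.2.2 s hs, M.od.sub_mem hs (hf.2.2 _ (hρ.2.2 s hs))⟩
    · rintro ⟨h1, h2⟩
      have h2' : s - f (ρ s) ∈ M.od := h2
      have := M.od.add_mem h2' (hf.2.2 _ h1)
      change s - f (ρ s) + f (ρ s) ∈ M.od at this
      simpa using this
  · intro i s
    refine Prod.ext (IsHom.app hρ i s) (Subtype.ext ?_)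
    show M.θ i s - f (ρ (M.θ i s)) = M.θ i (s - f (ρ s))
    rw [IsHom.app hρ, IsHom.app hf, map_sub]

theorem no_free [CharZero k] (M V : GSupMod k (Fin 2)) (hM : VCat k 2 M)
    (hnp : NoProjSummands (VCat k 2) M)
    (g : V.carrier →ₗ[k] M.carrier) (φ : M.carrier →ₗ[k] V.carrier)
    (hg : IsGr V M g) (h : ∀ v, φ (M.θ 0 (M.θ 1 (g v))) = v) (v : V.carrier) : v = 0 := by
  obtain ⟨h0, h1, h2⟩ := (vcat_iff M).1 hM
  have hf := fromFree_hom V M hM g hg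
  have hinj : Function.Injective (fromFree V M g) := by
    rw [injective_iff_map_eq_zero]
    intro u hu
    obtain ⟨x, y, w, z, rfl⟩ := free_cases V u
    rw [fromFree_apply] at hu
    have hx : x = 0 := by
      have := congrArg (fun m => φ (M.θ 0 (M.θ 1 m))) hu
      simpa [h0, h1, h2, h] using this
    subst hx
    have hy : y = 0 := by
      have := congrArg (fun m => φ (M.θ 1 m)) hu
      simpa [h0, h1, h2, h] using this
    have hw : w = 0 := by
      have := congrArg (fun m => φ (M.θ 0 m)) hu
      simpa [h0, h1, h2, h] using this
    subst hy hw
    have hz : z = 0 := by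
      have := congrArg (fun m => φ m) hu
      simpa [h0, h1, h2, h] using this
    rw [hz, fmk_zero]
  obtain ⟨ρ, hρ, he⟩ := (free_injective V).2 (freeObj V) M (fromFree V M g) LinearMap.id
    (free_vcat V) hM hf hinj ⟨fun i => rfl, fun m hm => hm, fun m hm => hm⟩
  obtain ⟨B, hB⟩ := split_dsum (freeObj V) M _ ρ hf hρ he
  have := hnp (freeObj V) B (free_projective V) hB (fmk V v 0 0 0)
  rw [← fmk_zero, fmk_inj] at this
  exact this.1

/-- The one dimensional even space. -/
def oneEv (k : Type) [Field k] : GSupMod k (Fin 2) where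
  carrier := k
  ev := ⊤
  od := ⊥
  isCompl := isCompl_top_bot
  θ _ := 0
  θ_ev := by simp
  θ_od := by simp

/-- The one dimensional odd space. -/
def oneOd (k : Type) [Field k] : GSupMod k (Fin 2) where
  carrier := k
  ev := ⊥
  od := ⊤
  isCompl := isCompl_bot_top
  θ _ := 0
  θ_ev := by simp
  θ_od := by simp

theorem exists_functional {E : Type} [AddCommGroup E] [Module k E] (W : Submodule k E) (v : E)
    (hv : v ∉ W) : ∃ φ : E →ₗ[k] k, φ v = 1 ∧ ∀ w ∈ W, φ w = 0 := by
  obtain ⟨f, hf, hW⟩ := Submodule.exists_dual_map_eq_bot_of_notMem hv inferInstance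
  refine ⟨(f v)⁻¹ • f, by simp [hf], fun w hw => ?_⟩
  have : f w ∈ W.map f := ⟨w, hw, rfl⟩
  rw [hW, Submodule.mem_bot] at this
  simp [this]

theorem theta_theta_zero [CharZero k] (M : GSupMod k (Fin 2)) (hM : VCat k 2 M)
    (hnp : NoProjSummands (VCat k 2) M) (m : M.carrier) : M.θ 0 (M.θ 1 m) = 0 := by
  have key : ∀ m, (m ∈ M.ev ∨ m ∈ M.od) → M.θ 0 (M.θ 1 m) = 0 := by
    intro m hm
    by_contra hne
    obtain ⟨φ, hφ⟩ : ∃ φ : M.carrier →ₗ[k] k, φ (M.θ 0 (M.θ 1 m)) = 1 := by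
      obtain ⟨φ, h, -⟩ := exists_functional (⊥ : Submodule k M.carrier) (M.θ 0 (M.θ 1 m))
        (by simpa using hne)
      exact ⟨φ, h⟩
    have hev0 : ∀ c : k, c = 0 → c • m ∈ M.ev := fun c h => by
      rw [h, zero_smul]; exact M.ev.zero_mem
    have hod0 : ∀ c : k, c = 0 → c • m ∈ M.od := fun c h => by
      rw [h, zero_smul]; exact M.od.zero_mem
    rcases hm with hm | hm
    · have := no_free M (oneEv k) hM hnp (LinearMap.toSpanSingleton k M.carrier m) φ
        ⟨fun c _ => M.ev.smul_mem c hm, fun c hc => hod0 c hc⟩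
        (fun (c : k) => by
          show φ (M.θ 0 (M.θ 1 (c • m))) = c
          rw [map_smul, map_smul, map_smul, hφ, smul_eq_mul, mul_one]) (1 : k)
      exact one_ne_zero (α := k) this
    · have := no_free M (oneOd k) hM hnp (LinearMap.toSpanSingleton k M.carrier m) φ
        ⟨fun c hc => hev0 c hc,
          fun c _ => M.od.smul_mem c hm⟩
        (fun (c : k) => by
          show φ (M.θ 0 (M.θ 1 (c • m))) = c
          rw [map_smul, map_smul, map_smul, hφ, smul_eq_mul, mul_one]) (1 : k)
      exact one_ne_zero (α := k) this
  obtain ⟨e, he, o, ho, rfl⟩ := exists_parts M m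
  simp [key e (Or.inl he), key o (Or.inr ho)]

/-! ### Rank one -/

/-- The free `V(a₁)`-supermodule on a graded space. -/
def freeOne (V : GSupMod k (Fin 1)) : GSupMod k (Fin 1) where
  carrier := V.carrier × V.carrier
  ev := V.ev.prod V.od
  od := V.od.prod V.ev
  isCompl := by
    constructor
    · rw [Submodule.disjoint_def]
      rintro ⟨x, y⟩ ⟨h1, h2⟩ ⟨g1, g2⟩
      have := eq_zero_of_parts V h1 g1
      have := eq_zero_of_parts V g2 h2
      simp_all
    · rw [codisjoint_iff, eq_top_iff]
      rintro ⟨x, y⟩ -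
      obtain ⟨xe, hxe, xo, hxo, rfl⟩ := exists_parts V x
      obtain ⟨ye, hye, yo, hyo, rfl⟩ := exists_parts V y
      refine Submodule.mem_sup.2 ⟨(xe, yo), ⟨hxe, hyo⟩, (xo, ye), ⟨hxo, hye⟩, ?_⟩
      simp [add_comm]
  θ _ := LinearMap.prod 0 (LinearMap.fst k _ _)
  θ_ev i := by
    rintro ⟨x, y⟩ ⟨h1, h2⟩
    exact ⟨V.od.zero_mem, h1⟩
  θ_od i := by
    rintro ⟨x, y⟩ ⟨h1, h2⟩
    exact ⟨V.ev.zero_mem, h1⟩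

theorem proj_one_exact [CharZero k] (P : GSupMod k (Fin 1)) (hP : IsProjective (VCat k 1) P) :
    LinearMap.ker (P.θ 0) = LinearMap.range (P.θ 0) := by
  have sq : ∀ x, P.θ 0 (P.θ 0 x) = 0 := by
    intro x
    have := LinearMap.congr_fun (hP.1 0 0) x
    change P.θ 0 (P.θ 0 x) + P.θ 0 (P.θ 0 x) = 0 at this
    rw [← two_smul k, smul_eq_zero] at this
    exact this.resolve_left two_ne_zero
  apply le_antisymm
  · intro x hx
    let π : (freeOne P).carrier →ₗ[k] P.carrier := LinearMap.coprod LinearMap.id (P.θ 0)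
    obtain ⟨h, hh, he⟩ := hP.2 (freeOne P) P π LinearMap.id
      (by
        intro i j
        refine LinearMap.ext fun u => ?_
        show (((0, 0) : P.carrier × P.carrier) + (0, 0) : P.carrier × P.carrier) = 0
        simp)
      hP.1
      (by
        refine ⟨?_, ?_, ?_⟩
        · intro i
          obtain rfl : i = 0 := Subsingleton.elim _ _
          refine LinearMap.ext ?_
          rintro ⟨x, y⟩
          show (0 : P.carrier) + P.θ 0 x = P.θ 0 (x + P.θ 0 y)
          simp [sq]
        · rintro ⟨x, y⟩ ⟨h1, h2⟩
          exact P.ev.add_mem h1 (P.θ_od _ _ h2)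
        · rintro ⟨x, y⟩ ⟨h1, h2⟩
          exact P.od.add_mem h1 (P.θ_ev _ _ h2))
      (fun x => ⟨((x, 0) : P.carrier × P.carrier), by
        show x + P.θ 0 0 = x
        simp⟩)
      ⟨fun i => rfl, fun m hm => hm, fun m hm => hm⟩
    have e1 : (h x).1 + P.θ 0 (h x).2 = x := LinearMap.congr_fun he x
    have e2 : h (P.θ 0 x) = ((0, (h x).1) : P.carrier × P.carrier) := IsHom.app hh 0 x
    rw [LinearMap.mem_ker.1 hx, map_zero] at e2
    have e3 : (0 : P.carrier) = (h x).1 := congrArg Prod.snd e2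
    rw [← e3, zero_add] at e1
    exact ⟨_, e1⟩
  · rintro _ ⟨x, rfl⟩
    exact sq x

/-- The homology of `T` is one-dimensional. -/
theorem syz_defect [CharZero k] (K T : GSupMod k (Fin 1)) (p : Bool) (hK : IsTrivial p K)
    (hT : Iso K T ∨ IsSyzygy (VCat k 1) K T) :
    Module.finrank k (LinearMap.ker (T.θ 0)) = Module.finrank k (LinearMap.range (T.θ 0)) + 1 := by
  rcases hT with ⟨e, he⟩ | ⟨-, P, π, i, ⟨hP, hπ, hsurj, -⟩, hi, hinj, hr⟩
  · have h0 : T.θ 0 = 0 := by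
      refine LinearMap.ext fun t => ?_
      obtain ⟨x, rfl⟩ := e.surjective t
      have := IsHom.app he 0 x
      rw [hK.2.1 0] at this
      simpa using this.symm
    have hr := LinearMap.finrank_range_add_finrank_ker (T.θ 0)
    rw [← e.finrank_eq, hK.1] at hr
    rw [h0, LinearMap.range_zero, finrank_bot] at *
    omega
  · have hex := proj_one_exact P hP
    have n1 := LinearMap.finrank_range_add_finrank_ker (P.θ 0)
    have n2 := LinearMap.finrank_range_add_finrank_ker (T.θ 0)
    have n3 := LinearMap.finrank_range_add_finrank_ker π
    rw [LinearMap.range_eq_top.2 hsurj, finrank_top, hK.1, ← hr,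
      LinearMap.finrank_range_of_inj hinj] at n3
    have hker : (LinearMap.ker (T.θ 0)).map i = LinearMap.ker (P.θ 0) := by
      apply le_antisymm
      · rintro _ ⟨t, ht, rfl⟩
        have ht' : T.θ 0 t = 0 := ht
        rw [LinearMap.mem_ker, ← IsHom.app hi, ht', map_zero]
      · intro x hx
        have hx2 : x ∈ LinearMap.range (P.θ 0) := hex ▸ hx
        obtain ⟨y, hy⟩ := hx2
        have : x ∈ LinearMap.range i := by
          rw [hr, LinearMap.mem_ker, ← hy, IsHom.app hπ, hK.2.1 0]; rfl
        obtain ⟨t, rfl⟩ := this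
        refine ⟨t, ?_, rfl⟩
        have hz := LinearMap.mem_ker.1 hx
        rw [← IsHom.app hi] at hz
        exact hinj (hz.trans (map_zero i).symm)
    have n4 : Module.finrank k (LinearMap.ker (T.θ 0)) =
        Module.finrank k (LinearMap.ker (P.θ 0)) := by
      rw [← hker]
      exact (Submodule.equivMapOfInjective i hinj _).finrank_eq
    rw [← hex] at n1
    omega

theorem cond2_defect [CharZero k] (M : GSupMod k (Fin 2)) (h2 : Cond2 M) (a : Fin 2 → k)
    (ha : a ≠ 0) : Module.finrank k (LinearMap.ker (actOf M a)) =
      Module.finrank k (LinearMap.range (actOf M a)) + 1 := by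
  obtain ⟨p, t, K, T, P, R, hK, hT, hP, ⟨φ, -, -, hφ⟩, ⟨ψ, -, -, hψ⟩⟩ := h2 a ha
  have hd := syz_defect K T p hK (hT.imp And.right And.right)
  have hex := proj_one_exact P hP
  let e : M.carrier ≃ₗ[k] T.carrier × P.carrier := φ.symm.trans ψ
  have he : ∀ m, e (actOf M a m) = LinearMap.prodMap (T.θ 0) (P.θ 0) (e m) := by
    intro m
    obtain ⟨r, rfl⟩ := φ.surjective m
    have := hφ 0 r
    simp only [Matrix.cons_val_zero] at this
    rw [← this]
    simp [e, hψ]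
  have n1 : Module.finrank k (LinearMap.ker (actOf M a)) =
      Module.finrank k (LinearMap.ker (LinearMap.prodMap (T.θ 0) (P.θ 0))) := by
    have hmap : (LinearMap.ker (actOf M a)).map (e : M.carrier →ₗ[k] T.carrier × P.carrier) =
        LinearMap.ker (LinearMap.prodMap (T.θ 0) (P.θ 0)) := by
      ext x
      obtain ⟨m, rfl⟩ := e.surjective x
      rw [LinearMap.mem_ker, ← he, Submodule.mem_map]
      constructor
      · rintro ⟨y, hy, hye⟩
        obtain rfl : y = m := e.injective hye
        rw [LinearMap.mem_ker.1 hy, map_zero]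
      · intro h
        exact ⟨m, e.map_eq_zero_iff.1 h, rfl⟩
    rw [← hmap]
    exact (LinearEquiv.finrank_map_eq e _).symm
  rw [LinearMap.ker_prodMap] at n1
  have n2 := LinearMap.finrank_range_add_finrank_ker (actOf M a)
  have n3 := LinearMap.finrank_range_add_finrank_ker (T.θ 0)
  have n4 := LinearMap.finrank_range_add_finrank_ker (P.θ 0)
  have n5 := e.finrank_eq
  rw [Module.finrank_prod] at n5
  have n6 : Module.finrank k ((LinearMap.ker (T.θ 0)).prod (LinearMap.ker (P.θ 0))) =
      Module.finrank k (LinearMap.ker (T.θ 0)) + Module.finrank k (LinearMap.ker (P.θ 0)) := by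
    rw [← Module.finrank_prod]
    exact (LinearEquiv.ofLinearMap
      (LinearMap.prod
        ((LinearMap.fst k _ _ ∘ₗ Submodule.subtype ((LinearMap.ker (T.θ 0)).prod
          (LinearMap.ker (P.θ 0)))).codRestrict (LinearMap.ker (T.θ 0)) fun x => x.2.1)
        ((LinearMap.snd k _ _ ∘ₗ Submodule.subtype ((LinearMap.ker (T.θ 0)).prod
          (LinearMap.ker (P.θ 0)))).codRestrict (LinearMap.ker (P.θ 0)) fun x => x.2.2))
      ((LinearMap.prodMap (Submodule.subtype (LinearMap.ker (T.θ 0)))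
        (Submodule.subtype (LinearMap.ker (P.θ 0)))).codRestrict
          ((LinearMap.ker (T.θ 0)).prod (LinearMap.ker (P.θ 0)))
        fun x => ⟨x.1.2, x.2.2⟩)
      (by ext <;> rfl) (by ext <;> rfl)).finrank_eq
  rw [← hex] at n4
  omega

/-! ### The socle and the injective hull -/

/-- The socle. -/
def soc (M : GSupMod k (Fin 2)) : Submodule k M.carrier :=
  LinearMap.ker (M.θ 0) ⊓ LinearMap.ker (M.θ 1)

theorem mem_soc (M : GSupMod k (Fin 2)) (m : M.carrier) :
    m ∈ soc M ↔ M.θ 0 m = 0 ∧ M.θ 1 m = 0 := Iff.rfl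

theorem ker_theta_gr {ι : Type} (M : GSupMod k ι) (i : ι) :
    IsGrSub M (LinearMap.ker (M.θ i)) := by
  intro e he o ho h
  rw [LinearMap.mem_ker, map_add] at h
  refine eq_zero_of_parts M ?_ (M.θ_ev i e he)
  rw [eq_neg_of_add_eq_zero_left h]
  exact M.ev.neg_mem (M.θ_od i o ho)

theorem soc_gr (M : GSupMod k (Fin 2)) : IsGrSub M (soc M) := fun e he o ho h =>
  ⟨ker_theta_gr M 0 e he o ho h.1, ker_theta_gr M 1 e he o ho h.2⟩

theorem soc_inv (M : GSupMod k (Fin 2)) : ∀ i, ∀ m ∈ soc M, M.θ i m ∈ soc M := by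
  intro i m hm
  obtain ⟨h0, h1⟩ := (mem_soc M m).1 hm
  fin_cases i
  · show M.θ 0 m ∈ soc M
    rw [h0]; exact Submodule.zero_mem _
  · show M.θ 1 m ∈ soc M
    rw [h1]; exact Submodule.zero_mem _

/-- The socle as an object. -/
def socObj (M : GSupMod k (Fin 2)) : GSupMod k (Fin 2) := subObj M (soc M) (soc_gr M) (soc_inv M)

theorem exists_hull [CharZero k] (M : GSupMod k (Fin 2)) (hM : VCat k 2 M)
    (hz : ∀ m, M.θ 0 (M.θ 1 m) = 0) :
    ∃ j : M.carrier →ₗ[k] (freeObj (socObj M)).carrier,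
      IsInjHull (VCat k 2) M (freeObj (socObj M)) j ∧
      ∀ m, fX (socObj M) (j m) = 0 := by
  obtain ⟨h0, h1, h2⟩ := (vcat_iff M).1 hM
  obtain ⟨p, hp, hpe⟩ := gr_extend (socObj M) M (socObj M) (soc M).subtype
    ⟨fun m hm => hm, fun m hm => hm⟩ (Submodule.subtype_injective _) LinearMap.id
    ⟨fun m hm => hm, fun m hm => hm⟩
  have hpe' : ∀ x : soc M, p (x : M.carrier) = x := fun x => LinearMap.congr_fun hpe x
  have hp0 : ∀ m ∈ soc M, p m = 0 → m = 0 := by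
    intro m hm h
    have := (hpe' ⟨m, hm⟩).symm.trans h
    exact congrArg Subtype.val this
  have hs0 : ∀ m, M.θ 0 m ∈ soc M := fun m =>
    (mem_soc M _).2 ⟨h0 m, by rw [h2, hz, neg_zero]⟩
  have hs1 : ∀ m, M.θ 1 m ∈ soc M := fun m => ⟨hz m, h1 m⟩
  refine ⟨toFree (socObj M) M p, ⟨free_injective _, toFree_hom _ M hM p hp, ?_, ?_⟩, ?_⟩
  · rw [injective_iff_map_eq_zero]
    intro m hm
    rw [toFree_apply, ← fmk_zero, fmk_inj] at hm
    obtain ⟨-, hb, hc, hd⟩ := hm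
    exact hp0 m ⟨hp0 _ (hs0 m) hc, hp0 _ (hs1 m) (neg_eq_zero.1 hb)⟩ hd
  · intro Q f hQ hf hinj
    have key : ∀ x : (socObj M).carrier, f (fmk (socObj M) 0 0 0 x) = 0 → x = 0 := by
      intro x hx
      obtain ⟨m, hm⟩ := x
      have e : toFree (socObj M) M p m = fmk (socObj M) 0 0 0 ⟨m, hm⟩ := by
        have hm0 : M.θ 0 m = 0 := hm.1
        have hm1 : M.θ 1 m = 0 := hm.2
        refine (toFree_apply _ _ _ _).trans ((fmk_inj _).2 ?_)
        rw [hm0, hm1]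
        refine ⟨by simp, by simp, by simp, hpe' ⟨m, hm⟩⟩
      rw [← e] at hx
      have : m = 0 := hinj (hx.trans (map_zero (f ∘ₗ toFree (socObj M) M p)).symm)
      exact Subtype.ext this
    rw [injective_iff_map_eq_zero]
    intro u hu
    obtain ⟨x, y, w, z, rfl⟩ := free_cases _ u
    have hx : x = 0 := by
      apply key
      have := IsHom.app hf 0 ((freeObj (socObj M)).θ 1 (fmk _ x y w z))
      rw [IsHom.app hf 1, hu, map_zero, map_zero, free_θ1, free_θ0] at this
      exact this
    have hw : w = 0 := by
      apply key
      have := IsHom.app hf 0 (fmk _ x y w z)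
      rw [hu, map_zero, free_θ0, hx] at this
      exact this
    have hy : y = 0 := by
      rw [← neg_eq_zero]
      apply key
      have := IsHom.app hf 1 (fmk _ x y w z)
      rw [hu, map_zero, free_θ1, hx] at this
      exact this
    subst hx hw hy
    rw [key z hu, fmk_zero]
  · intro m
    rw [toFree_apply, fX_mk, hz, map_zero]

theorem hull_image_gr {ι : Type} (M I : GSupMod k ι) (j : M.carrier →ₗ[k] I.carrier)
    (hj : IsHom M I j) : IsGrSub I (LinearMap.range j) := by
  rintro e he o ho ⟨m, hm⟩
  obtain ⟨e', he', o', ho', rfl⟩ := exists_parts M m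
  rw [map_add] at hm
  have h1 : j e' - e = o - j o' := by
    rw [sub_eq_sub_iff_add_eq_add, hm]; abel
  have h2 : j e' - e = 0 := eq_zero_of_parts I (I.ev.sub_mem (hj.2.1 _ he') he)
    (h1 ▸ I.od.sub_mem ho (hj.2.2 _ ho'))
  exact ⟨e', sub_eq_zero.1 h2⟩

theorem radical_two (M : GSupMod k (Fin 2)) :
    radical M = LinearMap.range (M.θ 0) ⊔ LinearMap.range (M.θ 1) := by
  apply le_antisymm
  · refine iSup_le fun i => ?_
    fin_cases i
    · exact le_sup_left
    · exact le_sup_right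
  · exact sup_le (le_iSup (fun i => LinearMap.range (M.θ i)) 0)
      (le_iSup (fun i => LinearMap.range (M.θ i)) 1)

theorem exists_cosyzygy [CharZero k] (M : GSupMod k (Fin 2)) (hM : VCat k 2 M)
    (hz : ∀ m, M.θ 0 (M.θ 1 m) = 0) :
    ∃ N, IsCosyzygy (VCat k 2) M N ∧ Module.finrank k (soc M) ≤ rk N := by
  obtain ⟨j, hj, hX⟩ := exists_hull M hM hz
  let V := socObj M
  let W := LinearMap.range j
  have hi : ∀ i, ∀ u ∈ W, (freeObj V).θ i u ∈ W := by
    rintro i _ ⟨m, rfl⟩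
    exact ⟨M.θ i m, IsHom.app hj.2.1 i m⟩
  let N := quotObj (freeObj V) W (hull_image_gr M _ j hj.2.1) hi
  have hN : VCat k 2 N := by
    intro a b
    refine LinearMap.ext fun x => ?_
    obtain ⟨u, rfl⟩ := W.mkQ_surjective x
    have := LinearMap.congr_fun (free_vcat V a b) u
    exact congrArg W.mkQ this
  refine ⟨N, ⟨hN, freeObj V, j, W.mkQ, hj, ⟨fun i => rfl, fun m hm => ⟨m, hm, rfl⟩,
    fun m hm => ⟨m, hm, rfl⟩⟩, W.mkQ_surjective, Submodule.ker_mkQ W⟩, ?_⟩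
  let q : N.carrier →ₗ[k] V.carrier := W.liftQ (fX V) (by
    rintro _ ⟨m, rfl⟩
    exact hX m)
  have hq : ∀ u, q (W.mkQ u) = fX V u := fun u => rfl
  have hrad : radical N ≤ LinearMap.ker q := by
    rw [radical_two]
    refine sup_le ?_ ?_
    · rintro _ ⟨x, rfl⟩
      obtain ⟨u, rfl⟩ := W.mkQ_surjective x
      obtain ⟨x, y, w, z, rfl⟩ := free_cases V u
      rfl
    · rintro _ ⟨x, rfl⟩
      obtain ⟨u, rfl⟩ := W.mkQ_surjective x
      obtain ⟨x, y, w, z, rfl⟩ := free_cases V u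
      rfl
  have hs : Function.Surjective ((radical N).liftQ q hrad) := by
    intro v
    refine ⟨(radical N).mkQ (W.mkQ (fI V v)), ?_⟩
    rfl
  exact LinearMap.finrank_le_finrank_of_surjective hs

theorem cosyzygy_rk [CharZero k] (M : GSupMod k (Fin 2)) (hM : VCat k 2 M)
    (hz : ∀ m, M.θ 0 (M.θ 1 m) = 0) (N : GSupMod k (Fin 2))
    (hN : IsCosyzygy (VCat k 2) M N) : rk N ≤ Module.finrank k (soc M) := by
  obtain ⟨-, I, j, p, hj, hp, hps, -⟩ := hN
  obtain ⟨j0, hj0, -⟩ := exists_hull M hM hz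
  let V := socObj M
  obtain ⟨h, hh, hhe⟩ := hj.1.2 M (freeObj V) j0 j hM hj0.1.1 hj0.2.1 hj0.2.2.1 hj.2.1
  obtain ⟨g, hg, hge⟩ := hj0.1.2 M I j j0 hM hj.1.1 hj.2.1 hj.2.2.1 hj0.2.1
  have hinj : Function.Injective h := hj0.2.2.2 I h hj.1.1 hh (by
    rw [hhe]; exact hj.2.2.1)
  have ginj : Function.Injective g := hj.2.2.2 _ g hj0.1.1 hg (by
    rw [hge]; exact hj0.2.2.1)
  have hdim : Module.finrank k (freeObj V).carrier = Module.finrank k I.carrier :=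
    le_antisymm (LinearMap.finrank_le_finrank_of_injective hinj)
      (LinearMap.finrank_le_finrank_of_injective ginj)
  have hsurj : Function.Surjective h :=
    (LinearMap.injective_iff_surjective_of_finrank_eq_finrank hdim).1 hinj
  let q : V.carrier →ₗ[k] N.carrier ⧸ radical N := (radical N).mkQ ∘ₗ p ∘ₗ h ∘ₗ fI V
  have hq : Function.Surjective q := by
    intro x
    obtain ⟨n, rfl⟩ := (radical N).mkQ_surjective x
    obtain ⟨i, rfl⟩ := hps n
    obtain ⟨u, rfl⟩ := hsurj i
    obtain ⟨x, y, w, z, rfl⟩ := free_cases V u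
    refine ⟨x, ?_⟩
    show (radical N).mkQ (p (h (fI V x))) = _
    rw [← sub_eq_zero, ← map_sub]
    refine (Submodule.Quotient.mk_eq_zero _).2 ?_
    have e : fmk V x y w z = fI V x + ((freeObj V).θ 0 (fmk V y 0 z 0) +
        (freeObj V).θ 1 (fmk V w 0 0 0)) := by
      simp [fI_apply, free_θ0, free_θ1, fmk_add]
    rw [e, map_add, map_add, sub_add_cancel_left, map_add, map_add, IsHom.app hh, IsHom.app hh,
      IsHom.app hp, IsHom.app hp, radical_two]
    exact Submodule.neg_mem _ (Submodule.add_mem_sup ⟨_, rfl⟩ ⟨_, rfl⟩)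
  exact LinearMap.finrank_le_finrank_of_surjective hq

theorem cond1_iff_dim [CharZero k] (M : GSupMod k (Fin 2)) (hM : VCat k 2 M)
    (hz : ∀ m, M.θ 0 (M.θ 1 m) = 0) : Cond1 M ↔ Module.finrank k (soc M) < rk M := by
  constructor
  · intro h
    obtain ⟨N, hN, hle⟩ := exists_cosyzygy M hM hz
    exact lt_of_le_of_lt hle (h N hN)
  · intro h N hN
    exact lt_of_le_of_lt (cosyzygy_rk M hM hz N hN) h

/-! ### The main argument -/

theorem actOf_two (M : GSupMod k (Fin 2)) (a : Fin 2 → k) (m : M.carrier) :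
    actOf M a m = a 0 • M.θ 0 m + a 1 • M.θ 1 m := by
  simp [actOf, Fin.sum_univ_two]

theorem omega_gen_of_parity (M : GSupMod k (Fin 2)) (a : Fin 2 → k)
    (hdef : Module.finrank k (LinearMap.ker (actOf M a)) =
      Module.finrank k (LinearMap.range (actOf M a)) + 1)
    (hle : LinearMap.range (actOf M a) ≤ LinearMap.ker (actOf M a))
    (v : M.carrier) (hv : v ∈ M.ev ∨ v ∈ M.od) (hvk : actOf M a v = 0)
    (hvr : v ∉ LinearMap.range (actOf M a)) : IsOmegaComponentGen M a v := by
  have aev : ∀ m ∈ M.ev, actOf M a m ∈ M.od := fun m hm => by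
    rw [actOf_two]
    exact M.od.add_mem (M.od.smul_mem _ (M.θ_ev _ _ hm)) (M.od.smul_mem _ (M.θ_ev _ _ hm))
  have aod : ∀ m ∈ M.od, actOf M a m ∈ M.ev := fun m hm => by
    rw [actOf_two]
    exact M.ev.add_mem (M.ev.smul_mem _ (M.θ_od _ _ hm)) (M.ev.smul_mem _ (M.θ_od _ _ hm))
  have hv0 : v ≠ 0 := by
    rintro rfl
    exact hvr (Submodule.zero_mem _)
  obtain ⟨φ, hφv, hφr, hφg⟩ : ∃ φ : M.carrier →ₗ[k] k, φ v = 1 ∧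
      (∀ w ∈ LinearMap.range (actOf M a), φ w = 0) ∧
      ((∀ w ∈ M.ev, φ w = 0) ∨ (∀ w ∈ M.od, φ w = 0)) := by
    rcases hv with hv | hv
    · have : v ∉ M.od ⊔ LinearMap.range (actOf M a) := by
        intro h
        obtain ⟨o, ho, _, ⟨x, rfl⟩, h⟩ := Submodule.mem_sup.1 h
        obtain ⟨e', he', o', ho', rfl⟩ := exists_parts M x
        rw [map_add] at h
        have h1 : v - actOf M a o' = o + actOf M a e' := by rw [← h]; abel
        have h2 : v - actOf M a o' = 0 := eq_zero_of_parts M (M.ev.sub_mem hv (aod _ ho'))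
          (h1 ▸ M.od.add_mem ho (aev _ he'))
        exact hvr ⟨o', (sub_eq_zero.1 h2).symm⟩
      obtain ⟨φ, h1, h2⟩ := exists_functional _ v this
      exact ⟨φ, h1, fun w hw => h2 w (Submodule.mem_sup_right hw),
        Or.inr fun w hw => h2 w (Submodule.mem_sup_left hw)⟩
    · have : v ∉ M.ev ⊔ LinearMap.range (actOf M a) := by
        intro h
        obtain ⟨o, ho, _, ⟨x, rfl⟩, h⟩ := Submodule.mem_sup.1 h
        obtain ⟨e', he', o', ho', rfl⟩ := exists_parts M x
        rw [map_add] at h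
        have h1 : v - actOf M a e' = o + actOf M a o' := by rw [← h]; abel
        have h2 : v - actOf M a e' = 0 := eq_zero_of_parts M
          (h1 ▸ M.ev.add_mem ho (aod _ ho')) (M.od.sub_mem hv (aev _ he'))
        exact hvr ⟨e', (sub_eq_zero.1 h2).symm⟩
      obtain ⟨φ, h1, h2⟩ := exists_functional _ v this
      exact ⟨φ, h1, fun w hw => h2 w (Submodule.mem_sup_right hw),
        Or.inl fun w hw => h2 w (Submodule.mem_sup_left hw)⟩
  have hker : ∀ x ∈ LinearMap.ker (actOf M a), φ x = 0 → x ∈ LinearMap.range (actOf M a) := by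
    have hs : LinearMap.range (actOf M a) ≤ LinearMap.ker (actOf M a) ⊓ LinearMap.ker φ :=
      le_inf hle hφr
    have hlt : LinearMap.ker (actOf M a) ⊓ LinearMap.ker φ < LinearMap.ker (actOf M a) := by
      refine lt_of_le_of_ne inf_le_left fun h => ?_
      have : v ∈ LinearMap.ker (actOf M a) ⊓ LinearMap.ker φ := by rw [h]; exact hvk
      have h0 : φ v = 0 := this.2
      rw [hφv] at h0
      exact one_ne_zero h0
    have hd := Submodule.finrank_lt_finrank_of_lt hlt
    have heq := Submodule.eq_of_le_of_finrank_le hs (by omega)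
    intro x hx hx'
    rw [heq]
    exact ⟨hx, hx'⟩
  refine ⟨hv0, Submodule.span k {v}, LinearMap.ker φ, ?_, rfl, ?_, ?_, hvk, ?_⟩
  · constructor
    · rw [Submodule.disjoint_def]
      intro x hx hx'
      obtain ⟨c, rfl⟩ := Submodule.mem_span_singleton.1 hx
      have : c = 0 := by simpa [hφv] using hx'
      simp [this]
    · rw [codisjoint_iff, eq_top_iff]
      intro x _
      refine Submodule.mem_sup.2 ⟨φ x • v, Submodule.smul_mem _ _ (Submodule.mem_span_singleton_self v),
        x - φ x • v, ?_, by abel⟩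
      simp [hφv]
  · apply le_antisymm _ (sup_le inf_le_left inf_le_left)
    rw [Submodule.span_singleton_le_iff_mem]
    rcases hv with hv | hv
    · exact Submodule.mem_sup_left ⟨Submodule.mem_span_singleton_self v, hv⟩
    · exact Submodule.mem_sup_right ⟨Submodule.mem_span_singleton_self v, hv⟩
  · apply le_antisymm _ (sup_le inf_le_left inf_le_left)
    intro x hx
    obtain ⟨e, he, o, ho, rfl⟩ := exists_parts M x
    have hx' : φ e + φ o = 0 := by simpa using hx
    refine Submodule.add_mem_sup ⟨?_, he⟩ ⟨?_, ho⟩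
    · rcases hφg with h | h
      · exact h e he
      · simpa [h o ho] using hx'
    · rcases hφg with h | h
      · simpa [h e he] using hx'
      · exact h o ho
  · apply le_antisymm
    · rintro x ⟨hx, hx'⟩
      obtain ⟨y, rfl⟩ := hker x hx' hx
      refine ⟨y - φ y • v, by simp [hφv], by simp [hvk]⟩
    · rintro _ ⟨y, -, rfl⟩
      exact ⟨hφr _ ⟨y, rfl⟩, hle ⟨y, rfl⟩⟩

theorem range_lt_part (M : GSupMod k (Fin 2)) (S T : Submodule k M.carrier)
    (hT : IsGrSub M T) (h : ∀ v ∈ T, (v ∈ M.ev ∨ v ∈ M.od) → v ∈ S) : T ≤ S := by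
  intro x hx
  obtain ⟨e, he, o, ho, rfl⟩ := exists_parts M x
  exact S.add_mem (h e (hT e he o ho hx) (Or.inl he)) (h o (hT.od he ho hx) (Or.inr ho))

theorem main_aux [CharZero k] (M : GSupMod k (Fin 2)) (hM : VCat k 2 M)
    (hnp : NoProjSummands (VCat k 2) M) (h2 : Cond2 M) : Cond1 M ↔ Cond3 M := by
  have hz := theta_theta_zero M hM hnp
  obtain ⟨h0, h1, hc⟩ := (vcat_iff M).1 hM
  rw [cond1_iff_dim M hM hz]
  have hquot := Submodule.finrank_quotient_add_finrank (radical M)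
  change rk M + _ = _ at hquot
  have hRS : radical M ≤ soc M := by
    rw [radical_two]
    refine sup_le ?_ ?_
    · rintro _ ⟨x, rfl⟩
      exact (mem_soc M _).2 ⟨h0 x, by rw [hc, hz, neg_zero]⟩
    · rintro _ ⟨x, rfl⟩
      exact ⟨hz x, h1 x⟩
  have hSk : ∀ a, soc M ≤ LinearMap.ker (actOf M a) := by
    intro a x hx
    obtain ⟨hx0, hx1⟩ := (mem_soc M x).1 hx
    rw [LinearMap.mem_ker, actOf_two, hx0, hx1, smul_zero, smul_zero, add_zero]
  have hrR : ∀ a, LinearMap.range (actOf M a) ≤ radical M := by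
    rintro a _ ⟨x, rfl⟩
    rw [actOf_two, radical_two]
    exact Submodule.add_mem_sup (Submodule.smul_mem _ _ ⟨x, rfl⟩) (Submodule.smul_mem _ _ ⟨x, rfl⟩)
  have hf1 := Submodule.finrank_mono hRS
  constructor
  · intro hlt
    refine ⟨h2, fun a ha => ?_⟩
    have hd := cond2_defect M h2 a ha
    have hn := LinearMap.finrank_range_add_finrank_ker (actOf M a)
    have hf2 := Submodule.finrank_mono (hrR a)
    have e1 : LinearMap.range (actOf M a) = radical M :=
      Submodule.eq_of_le_of_finrank_le (hrR a) (by omega)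
    have e2 : radical M = soc M := Submodule.eq_of_le_of_finrank_le hRS (by omega)
    constructor
    · rintro v ⟨hv0, L, P, hLP, rfl, -, -, hav, hP⟩ hv
      rw [← e1] at hv
      obtain ⟨x, rfl⟩ := hv
      have hx : x ∈ Submodule.span k {actOf M a x} ⊔ P := by rw [hLP.sup_eq_top]; trivial
      obtain ⟨l, hl, q, hq, hlq⟩ := Submodule.mem_sup.1 hx
      obtain ⟨c, rfl⟩ := Submodule.mem_span_singleton.1 hl
      have hq' : actOf M a x = actOf M a q := by
        conv_lhs => rw [← hlq]
        rw [map_add, map_smul, hav, smul_zero, zero_add]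
      have hmem : actOf M a x ∈ P ⊓ LinearMap.ker (actOf M a) := by
        rw [hP, hq']; exact ⟨q, hq, rfl⟩
      exact hv0 (Submodule.disjoint_def.1 hLP.disjoint _
        (Submodule.mem_span_singleton_self _) hmem.1)
    · intro b hb m hm
      by_contra hcon
      push Not at hcon
      obtain ⟨ham, hbm⟩ := hcon
      apply hm
      rw [e2]
      rw [actOf_two] at ham hbm
      have hdet : a 0 * b 1 - a 1 * b 0 ≠ 0 := by
        intro hdet
        apply hb
        rw [Submodule.mem_span_singleton]
        by_cases ha0 : a 0 = 0
        · have ha1 : a 1 ≠ 0 := by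
            intro ha1
            apply ha
            ext i
            fin_cases i
            · exact ha0
            · exact ha1
          refine ⟨b 1 / a 1, ?_⟩
          have hb0 : b 0 = 0 := by simpa [ha0, ha1] using hdet
          ext i
          fin_cases i
          · simp [ha0, hb0]
          · simp [ha1]
        · refine ⟨b 0 / a 0, ?_⟩
          ext i
          fin_cases i
          · simp [ha0]
          · simp only [Pi.smul_apply, smul_eq_mul]
            show b 0 / a 0 * a 1 = b 1
            field_simp
            linear_combination -hdet
      have k0 : (a 0 * b 1 - a 1 * b 0) • M.θ 0 m = 0 := by
        have : (a 0 * b 1 - a 1 * b 0) • M.θ 0 m =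
            b 1 • (a 0 • M.θ 0 m + a 1 • M.θ 1 m) - a 1 • (b 0 • M.θ 0 m + b 1 • M.θ 1 m) := by
          module
        rw [this, ham, hbm]; simp
      have k1 : (a 0 * b 1 - a 1 * b 0) • M.θ 1 m = 0 := by
        have : (a 0 * b 1 - a 1 * b 0) • M.θ 1 m =
            a 0 • (b 0 • M.θ 0 m + b 1 • M.θ 1 m) - b 0 • (a 0 • M.θ 0 m + a 1 • M.θ 1 m) := by
          module
        rw [this, ham, hbm]; simp
      exact ⟨(smul_eq_zero.1 k0).resolve_left hdet, (smul_eq_zero.1 k1).resolve_left hdet⟩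
  · rintro ⟨-, h3⟩
    have ha : (![1, 0] : Fin 2 → k) ≠ 0 := fun h => one_ne_zero (congrFun h 0)
    obtain ⟨hA, hB⟩ := h3 ![1, 0] ha
    have hd := cond2_defect M h2 _ ha
    have hn := LinearMap.finrank_range_add_finrank_ker (actOf M ![1, 0])
    have e2 : radical M = soc M := by
      apply le_antisymm hRS
      intro m hm
      by_contra hmr
      have := hB ![0, 1] (by
        rw [Submodule.mem_span_singleton]
        rintro ⟨c, hc⟩
        have := congrFun hc 1
        simp at this) m hmr
      rcases this with h | h
      · exact h (hSk _ hm)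
      · exact h (hSk _ hm)
    have e1 : radical M ≤ LinearMap.range (actOf M ![1, 0]) := by
      refine range_lt_part M _ _ (e2 ▸ soc_gr M) fun v hv hp => ?_
      by_contra hvr
      exact hA v (omega_gen_of_parity M _ hd ((hrR _).trans (hRS.trans (hSk _))) v hp
        (hSk _ (hRS hv)) hvr) hv
    have hf3 := Submodule.finrank_mono e1
    rw [← e2]
    omega

end SupCat


open SupCat SupCat.GSupMod in
/-- Let `M` be a `V(a₂)`-supermodule with no projective
submodules satisfying condition (2).  Then `M` satisfies condition (1) if and
only if `M` satisfies condition (3). -/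
theorem cond1_iff_cond3
    (k : Type) [Field k] [IsAlgClosed k] [CharZero k]
    (M : GSupMod k (Fin 2)) (hM : VCat k 2 M)
    (hnp : NoProjSummands (VCat k 2) M)
    (h2 : Cond2 M) :
    Cond1 M ↔ Cond3 M := by
  exact main_aux M hM hnp h2
end
end
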